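/- arXiv:1506.02126 — 2 statements merged into one kernel-verified Lean document; each statement's English description precedes it below -/
import Mathlib

section
/- There exist constants c_λ, d_λ > 0 and m₀ ∈ ℕ (depending only on λ) such that for every g ∈ A^λ(S²) and every m ≥ m₀, the projection S_m g := Σ_{l=0}^{m} Q_l g onto spherical polynomials of degree ≤ m satisfies ‖g − S_m g‖_{L∞(S²)} ≤ (c_λ + m·d_λ)·exp(−λ*(m))·‖g‖_{A^λ(S²)}. -/
open scoped Real ENNReal
open MeasureTheory

noncomputable section

/-- The quantity `B_λ = sup {r ≥ 0 | λ(r) < ∞}` (as an extended real number). -/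
def Blam (lam : ℝ → EReal) : EReal :=
  sSup {x : EReal | ∃ r : ℝ, 0 ≤ r ∧ lam r ≠ ⊤ ∧ x = (r : EReal)}

/-- The quantity `exp (-λ*(s))`, where `λ*(s) = sup_{r ≥ 0} (s r - λ(r))` is the Fenchel
conjugate of `λ` (with the convention `exp (-∞) = 0`). -/
def expNegLamStar (lam : ℝ → EReal) (s : ℝ) : ℝ :=
  sInf {y : ℝ | ∃ r : ℝ, 0 ≤ r ∧ lam r ≠ ⊤ ∧ y = Real.exp ((lam r).toReal - s * r)}

/-- The boundary `∂E_t` of the closed ellipse with foci `±1` and semi-axes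
`cosh t`, `sinh t`. -/
def ellipseBoundary (t : ℝ) : Set ℂ :=
  {z : ℂ | z.re ^ 2 / Real.cosh t ^ 2 + z.im ^ 2 / Real.sinh t ^ 2 = 1}

/-- The closed ellipse `E_t` with foci `±1` and semi-axes `cosh t`, `sinh t`. -/
def ellipseClosed (t : ℝ) : Set ℂ :=
  {z : ℂ | z.re ^ 2 / Real.cosh t ^ 2 + z.im ^ 2 / Real.sinh t ^ 2 ≤ 1}

/-- The region `E_{B_λ} = ⋃_{0 < t < B_λ} E_t`. -/
def ellipseRegion (lam : ℝ → EReal) : Set ℂ :=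
  {z : ℂ | ∃ t : ℝ, 0 < t ∧ ((t : ℝ) : EReal) < Blam lam ∧ z ∈ ellipseClosed t}

/-- The `n`-th Legendre polynomial, via the Rodrigues formula
`P_n = (1/(2^n n!)) dⁿ/dxⁿ (x² - 1)ⁿ` (so that `P_n(1) = 1`). -/
def legendreP (n : ℕ) : Polynomial ℝ :=
  Polynomial.C (1 / ((2 : ℝ) ^ n * n.factorial)) *
    (⇑Polynomial.derivative)^[n] ((Polynomial.X ^ 2 - 1) ^ n)

/-- The circular average `(Mg)(x,t)`, written using an orthonormal frame `u, v` of the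
orthogonal complement of `x`:
`(Mg)(x,t) = (1/2π) ∫_0^{2π} g(t x + √(1-t²)(cos s · u + sin s · v)) ds`. -/
def circAvg (g : EuclideanSpace ℝ (Fin 3) → ℝ) (x u v : EuclideanSpace ℝ (Fin 3)) (t : ℝ) :
    ℝ :=
  (1 / (2 * π)) *
    ∫ s in (0 : ℝ)..(2 * π),
      g (t • x + Real.sqrt (1 - t ^ 2) • (Real.cos s • u + Real.sin s • v))

/-- The `L²(S²)`-orthogonal projection onto the spherical harmonics of degree `m`:
`(Q_m g)(x) = ((2m+1)/(4π)) ∫_{S²} P_m(⟨x,y⟩) g(y) dσ(y)`. -/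
def sphHarmProj (m : ℕ) (g : EuclideanSpace ℝ (Fin 3) → ℝ)
    (x : EuclideanSpace ℝ (Fin 3)) : ℝ :=
  ((2 * (m : ℝ) + 1) / (4 * π)) *
    ∫ y : Metric.sphere (0 : EuclideanSpace ℝ (Fin 3)) 1,
      (legendreP m).eval ((inner ℝ x (y : EuclideanSpace ℝ (Fin 3)) : ℝ)) * g y
      ∂(volume : Measure (EuclideanSpace ℝ (Fin 3))).toSphere

/-- Membership of `g` in `A^λ(S²)` with norm bound `Ng`: for every point `x ∈ S²` and every
orthonormal frame `u, v` of its orthogonal complement, the circular average `(Mg)(x,·)` has a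
holomorphic extension to `E_{B_λ}` whose `A^λ(-1,1)`-norm is bounded by `Ng`. -/
def memAlambdaSphere (lam : ℝ → EReal) (g : EuclideanSpace ℝ (Fin 3) → ℝ) (Ng : ℝ) : Prop :=
  ∀ x u v : EuclideanSpace ℝ (Fin 3), ‖x‖ = 1 → ‖u‖ = 1 → ‖v‖ = 1 →
    (inner ℝ x u : ℝ) = 0 → (inner ℝ x v : ℝ) = 0 → (inner ℝ u v : ℝ) = 0 →
    ∃ h : ℂ → ℂ, DifferentiableOn ℂ h (ellipseRegion lam) ∧
      (∀ t ∈ Set.Ioo (-1 : ℝ) 1, h t = (circAvg g x u v t : ℂ)) ∧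
      (∀ t : ℝ, 0 < t → ((t : ℝ) : EReal) < Blam lam →
        ∀ z ∈ ellipseBoundary t, Real.exp (-(lam t).toReal) * ‖h z‖ ≤ Ng)

end


/-- Polar coordinates in the upper half-plane, with the angle parametrised by its cosine. -/
lemma lintegral_upperHalfPlane_cos_polar (H : ℝ × ℝ → ℝ≥0∞) (hH : Measurable H) :
    ∫⁻ z, ∫⁻ ρ in Set.Ioi (0 : ℝ), ENNReal.ofReal ρ * H (z, ρ) =
      ∫⁻ r in Set.Ioi (0 : ℝ), ∫⁻ t in Set.Ioo (-1 : ℝ) 1,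
        ENNReal.ofReal (r ^ 2) * H (r * t, r * √(1 - t ^ 2)) := by
  set K : ℝ × ℝ → ℝ≥0∞ := fun q =>
    (Set.Ioi (0 : ℝ)).indicator (fun _ => ENNReal.ofReal q.2 * H q) q.2 with hK
  have hKm : Measurable K := by
    have : K = {q : ℝ × ℝ | 0 < q.2}.indicator (fun q => ENNReal.ofReal q.2 * H q) := by
      ext q; simp [hK, Set.indicator]
    rw [this]
    exact Measurable.indicator (by fun_prop) (measurableSet_lt measurable_const measurable_snd)
  have h1 : ∫⁻ z, ∫⁻ ρ in Set.Ioi (0 : ℝ), ENNReal.ofReal ρ * H (z, ρ) = ∫⁻ q, K q := by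
    rw [Measure.volume_eq_prod, lintegral_prod _ hKm.aemeasurable]
    refine lintegral_congr fun z => ?_
    rw [← lintegral_indicator measurableSet_Ioi]
    refine lintegral_congr fun ρ => ?_
    simp [hK, Set.indicator]
  rw [h1, ← lintegral_comp_polarCoord_symm]
  have h2 : polarCoord.target = Set.Ioi (0 : ℝ) ×ˢ Set.Ioo (-π) π := rfl
  rw [h2, Measure.volume_eq_prod, ← Measure.prod_restrict, lintegral_prod]
  swap
  · refine Measurable.aemeasurable ?_
    have := hKm.comp continuous_polarCoord_symm.measurable
    exact (ENNReal.measurable_ofReal.comp measurable_fst).mul this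
  refine setLIntegral_congr_fun measurableSet_Ioi fun r hr => ?_
  have hr0 : (0 : ℝ) < r := hr
  have himg : Real.cos '' Set.Ioo 0 π = Set.Ioo (-1) 1 := by
    ext y
    constructor
    · rintro ⟨a, ha, rfl⟩
      constructor
      · rw [← Real.cos_pi]
        exact Real.strictAntiOn_cos ⟨ha.1.le, ha.2.le⟩ ⟨Real.pi_pos.le, le_rfl⟩ ha.2
      · rw [← Real.cos_zero]
        exact Real.strictAntiOn_cos ⟨le_rfl, Real.pi_pos.le⟩ ⟨ha.1.le, ha.2.le⟩ ha.1
    · rintro ⟨hy1, hy2⟩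
      exact ⟨Real.arccos y, ⟨Real.arccos_pos.2 hy2,
        lt_of_le_of_ne (Real.arccos_le_pi y) fun h => by
          rw [Real.arccos_eq_pi] at h; linarith⟩, Real.cos_arccos hy1.le hy2.le⟩
  have h3 := lintegral_image_eq_lintegral_abs_deriv_mul (s := Set.Ioo 0 π) measurableSet_Ioo
    (fun a _ => (Real.hasDerivAt_cos a).hasDerivWithinAt)
    (Real.injOn_cos.mono Set.Ioo_subset_Icc_self)
    (fun t => ENNReal.ofReal (r ^ 2) * H (r * t, r * √(1 - t ^ 2)))
  rw [himg] at h3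
  rw [h3, ← lintegral_indicator measurableSet_Ioo, ← lintegral_indicator measurableSet_Ioo]
  refine lintegral_congr fun a => ?_
  by_cases ha : a ∈ Set.Ioo 0 π
  · have hs : 0 < Real.sin a := Real.sin_pos_of_mem_Ioo ha
    have ha' : a ∈ Set.Ioo (-π) π := ⟨by linarith [ha.1, Real.pi_pos], ha.2⟩
    have hsq : √(1 - Real.cos a ^ 2) = Real.sin a := by
      rw [← Real.sin_sq, Real.sqrt_sq hs.le]
    simp only [Set.indicator_of_mem ha, Set.indicator_of_mem ha', hK, polarCoord_symm_apply]
    rw [Set.indicator_of_mem (show r * Real.sin a ∈ Set.Ioi 0 from mul_pos hr0 hs), hsq, abs_neg,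
      abs_of_pos hs, smul_eq_mul, ← mul_assoc, ← mul_assoc, ← ENNReal.ofReal_mul hr0.le,
      ← ENNReal.ofReal_mul hs.le]
    congr 2
    ring
  · rw [Set.indicator_of_notMem ha]
    by_cases ha' : a ∈ Set.Ioo (-π) π
    · have ha0 : a ≤ 0 := by
        by_contra! h
        exact ha ⟨h, ha'.2⟩
      have hs : Real.sin a ≤ 0 := Real.sin_nonpos_of_nonpos_of_neg_pi_le ha0 ha'.1.le
      rw [Set.indicator_of_mem ha']
      simp only [hK, polarCoord_symm_apply]
      rw [Set.indicator_of_notMem, smul_zero]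
      simpa using mul_nonpos_of_nonneg_of_nonpos hr0.le hs
    · rw [Set.indicator_of_notMem ha']

/-- Integration over `ℝ³` in the coordinates of an orthonormal basis. -/
lemma lintegral_orthonormalBasis (b : OrthonormalBasis (Fin 3) ℝ (EuclideanSpace ℝ (Fin 3)))
    (F : EuclideanSpace ℝ (Fin 3) → ℝ≥0∞) (hF : Measurable F) :
    ∫⁻ y, F y = ∫⁻ z : ℝ, ∫⁻ p : ℝ × ℝ, F (z • b 0 + (p.1 • b 1 + p.2 • b 2)) := by
  have h1 := b.measurePreserving_repr_symm.comp
    ((EuclideanSpace.volume_preserving_symm_measurableEquiv_toLp (Fin 3)).symm.comp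
      (((volume_preserving_piFinSuccAbove (fun _ : Fin 3 => ℝ) 0).symm).comp
        ((MeasurePreserving.id (volume : Measure ℝ)).prod
          ((volume_preserving_finTwoArrow ℝ).symm))))
  rw [← h1.lintegral_comp hF, lintegral_prod]
  swap
  · exact (hF.comp h1.measurable).aemeasurable
  refine lintegral_congr fun z => lintegral_congr fun p => congrArg F ?_
  rw [← b.repr.injective.eq_iff]
  simp only [Function.comp, LinearIsometryEquiv.apply_symm_apply, map_add, map_smul,
    OrthonormalBasis.repr_self]
  ext i
  fin_cases i <;> simp [MeasurableEquiv.piFinSuccAbove, MeasurableEquiv.finTwoArrow, Fin.insertNthEquiv]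

/-- The parametrisation of the unit sphere by height `t` above the equator orthogonal to `b 0`
and longitude `s`. -/
noncomputable def sphereParam (b : OrthonormalBasis (Fin 3) ℝ (EuclideanSpace ℝ (Fin 3))) (p : ℝ × ℝ) :
    EuclideanSpace ℝ (Fin 3) :=
  p.2 • b 0 + √(1 - p.2 ^ 2) • (Real.cos p.1 • b 1 + Real.sin p.1 • b 2)

lemma continuous_sphereParam (b : OrthonormalBasis (Fin 3) ℝ (EuclideanSpace ℝ (Fin 3))) :
    Continuous (sphereParam b) := by
  unfold sphereParam
  fun_prop

lemma lintegral_spherical (b : OrthonormalBasis (Fin 3) ℝ (EuclideanSpace ℝ (Fin 3)))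
    (F : EuclideanSpace ℝ (Fin 3) → ℝ≥0∞) (hF : Measurable F) :
    ∫⁻ y, F y = ∫⁻ s in Set.Ioo (-π) π, ∫⁻ r in Set.Ioi (0 : ℝ), ∫⁻ t in Set.Ioo (-1 : ℝ) 1,
      ENNReal.ofReal (r ^ 2) * F (r • sphereParam b (s, t)) := by
  rw [lintegral_orthonormalBasis b F hF]
  have h1 : ∀ z : ℝ, ∫⁻ p : ℝ × ℝ, F (z • b 0 + (p.1 • b 1 + p.2 • b 2)) =
      ∫⁻ s in Set.Ioo (-π) π, ∫⁻ ρ in Set.Ioi (0 : ℝ),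
        ENNReal.ofReal ρ * F (z • b 0 + ρ • (Real.cos s • b 1 + Real.sin s • b 2)) := by
    intro z
    rw [← lintegral_comp_polarCoord_symm]
    have h2 : polarCoord.target = Set.Ioi (0 : ℝ) ×ˢ Set.Ioo (-π) π := rfl
    rw [h2, Measure.volume_eq_prod, ← Measure.prod_restrict, lintegral_prod_symm]
    · refine lintegral_congr fun s => lintegral_congr fun ρ => ?_
      simp [smul_add, smul_smul]
    · simp only [polarCoord_symm_apply]
      refine Measurable.aemeasurable ?_
      simp only [smul_eq_mul]
      fun_prop
  simp_rw [h1]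
  rw [lintegral_lintegral_swap]
  · refine lintegral_congr fun s => ?_
    rw [lintegral_upperHalfPlane_cos_polar
      (fun q => F (q.1 • b 0 + q.2 • (Real.cos s • b 1 + Real.sin s • b 2))) (by fun_prop)]
    simp [sphereParam, smul_add, smul_smul, mul_assoc]
  · refine Measurable.aemeasurable ?_
    refine Measurable.lintegral_prod_right' (f := fun q : (ℝ × ℝ) × ℝ => ENNReal.ofReal q.2 *
      F (q.1.1 • b 0 + q.2 • (Real.cos q.1.2 • b 1 + Real.sin q.1.2 • b 2))) ?_
    fun_prop

lemma norm_sphereParam (b : OrthonormalBasis (Fin 3) ℝ (EuclideanSpace ℝ (Fin 3))) {s t : ℝ}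
    (ht : t ∈ Set.Icc (-1 : ℝ) 1) : ‖sphereParam b (s, t)‖ = 1 := by
  have h : 0 ≤ 1 - t ^ 2 := by nlinarith [ht.1, ht.2]
  rw [← b.repr.norm_map, EuclideanSpace.norm_eq, Real.sqrt_eq_one]
  simp only [sphereParam, map_add, map_smul, OrthonormalBasis.repr_self, Fin.sum_univ_three]
  simp [mul_pow, Real.sq_sqrt h]
  nlinarith [Real.sin_sq_add_cos_sq s]

lemma inner_sphereParam (b : OrthonormalBasis (Fin 3) ℝ (EuclideanSpace ℝ (Fin 3))) (p : ℝ × ℝ) :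
    (inner ℝ (b 0) (sphereParam b p) : ℝ) = p.2 := by
  simp [sphereParam, inner_add_right, inner_smul_right, b.inner_eq_ite]

open scoped Pointwise in
/-- Archimedes' hat-box theorem: the surface measure of `S²` is the image of the planar Lebesgue
measure under the parametrisation by longitude and height. -/
lemma map_toSphere_eq_map_sphereParam
    (b : OrthonormalBasis (Fin 3) ℝ (EuclideanSpace ℝ (Fin 3))) :
    (volume : Measure (EuclideanSpace ℝ (Fin 3))).toSphere.map Subtype.val =
      ((volume.restrict (Set.Ioo (-π) π)).prod (volume.restrict (Set.Ioo (-1 : ℝ) 1))).map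
        (sphereParam b) := by
  have hme : MeasurableEmbedding
      (Subtype.val : Metric.sphere (0 : EuclideanSpace ℝ (Fin 3)) 1 → _) :=
    MeasurableEmbedding.subtype_coe Metric.isClosed_sphere.measurableSet
  ext A hA
  have hPm : MeasurableSet (sphereParam b ⁻¹' A) := (continuous_sphereParam b).measurable hA
  rw [Measure.map_apply measurable_subtype_coe hA,
    Measure.map_apply (continuous_sphereParam b).measurable hA,
    Measure.toSphere_apply' _ (measurable_subtype_coe hA)]
  set C : Set (EuclideanSpace ℝ (Fin 3)) := Set.Ioo (0 : ℝ) 1 •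
    (Subtype.val '' (Subtype.val ⁻¹' A : Set (Metric.sphere (0 : EuclideanSpace ℝ (Fin 3)) 1)))
    with hC
  have hmem : ∀ y, y ∈ C ↔ (0 < ‖y‖ ∧ ‖y‖ < 1) ∧ ‖y‖⁻¹ • y ∈ A := by
    intro y
    constructor
    · rintro ⟨r, hr, _, ⟨w, hw, rfl⟩, rfl⟩
      have hw1 : ‖(w : EuclideanSpace ℝ (Fin 3))‖ = 1 := by simp
      have hn : ‖r • (w : EuclideanSpace ℝ (Fin 3))‖ = r := by
        rw [norm_smul, hw1, mul_one, Real.norm_of_nonneg hr.1.le]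
      refine ⟨by rwa [hn], ?_⟩
      simp only [hn, smul_smul, inv_mul_cancel₀ hr.1.ne', one_smul]
      exact hw
    · rintro ⟨hy, hyA⟩
      refine ⟨‖y‖, hy, ‖y‖⁻¹ • y, ⟨⟨‖y‖⁻¹ • y, ?_⟩, hyA, rfl⟩, ?_⟩
      · simp [norm_smul, hy.1.ne']
      · simp [smul_smul, hy.1.ne']
  have hCm : MeasurableSet C := by
    have : C = {y | (0 < ‖y‖ ∧ ‖y‖ < 1) ∧ ‖y‖⁻¹ • y ∈ A} := Set.ext hmem
    rw [this]
    have hA' : MeasurableSet {y : EuclideanSpace ℝ (Fin 3) | ‖y‖⁻¹ • y ∈ A} :=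
      (show Measurable fun y : EuclideanSpace ℝ (Fin 3) => ‖y‖⁻¹ • y by fun_prop) hA
    exact ((measurableSet_lt measurable_const measurable_norm).inter
      (measurableSet_lt measurable_norm measurable_const)).inter hA'
  rw [← lintegral_indicator_one hCm, lintegral_spherical b _ (measurable_one.indicator hCm),
    ← lintegral_indicator_one hPm, lintegral_prod _ (measurable_one.indicator hPm).aemeasurable,
    ← lintegral_const_mul']
  swap
  · simp
  refine lintegral_congr fun s => ?_
  have hin : ∀ r ∈ Set.Ioi (0 : ℝ), ∫⁻ t in Set.Ioo (-1 : ℝ) 1,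
      ENNReal.ofReal (r ^ 2) * C.indicator 1 (r • sphereParam b (s, t)) =
      (Set.Iio (1 : ℝ)).indicator (fun r => ENNReal.ofReal (r ^ 2)) r *
        ∫⁻ t in Set.Ioo (-1 : ℝ) 1, (sphereParam b ⁻¹' A).indicator 1 (s, t) := by
    intro r hr
    have hr0 : (0 : ℝ) < r := hr
    rw [← lintegral_const_mul']
    swap
    · by_cases h : r ∈ Set.Iio (1 : ℝ)
      · simp [Set.indicator_of_mem h]
      · simp [Set.indicator_of_notMem h]
    refine setLIntegral_congr_fun measurableSet_Ioo fun t ht => ?_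
    have hn : ‖r • sphereParam b (s, t)‖ = r := by
      rw [norm_smul, norm_sphereParam b (Set.Ioo_subset_Icc_self ht), mul_one,
        Real.norm_of_nonneg hr0.le]
    have hiff : r • sphereParam b (s, t) ∈ C ↔ r < 1 ∧ sphereParam b (s, t) ∈ A := by
      rw [hmem, hn, smul_smul, inv_mul_cancel₀ hr0.ne', one_smul]
      tauto
    by_cases h1 : r < 1 <;> by_cases h2 : sphereParam b (s, t) ∈ A <;>
      simp [Set.indicator, hiff, h1, h2]
  rw [setLIntegral_congr_fun measurableSet_Ioi hin, lintegral_mul_const _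
    ((by fun_prop : Measurable fun r : ℝ => ENNReal.ofReal (r ^ 2)).indicator measurableSet_Iio),
    lintegral_indicator measurableSet_Iio, Measure.restrict_restrict measurableSet_Iio,
    ← mul_assoc]
  have h3 : ∫⁻ r in Set.Iio (1 : ℝ) ∩ Set.Ioi 0, ENNReal.ofReal (r ^ 2) =
      ENNReal.ofReal (1 / 3) := by
    rw [Set.inter_comm, Set.Ioi_inter_Iio, Measure.restrict_congr_set Ioo_ae_eq_Ioc,
      ← ofReal_integral_eq_lintegral_ofReal]
    · rw [← intervalIntegral.integral_of_le zero_le_one, integral_pow]; norm_num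
    · exact (intervalIntegral.intervalIntegrable_pow 2).1
    · exact Filter.Eventually.of_forall fun r => sq_nonneg r
  have h4 : (Module.finrank ℝ (EuclideanSpace ℝ (Fin 3)) : ℝ≥0∞) * ENNReal.ofReal (1 / 3) = 1 := by
    rw [finrank_euclideanSpace_fin, ← ENNReal.ofReal_natCast, ← ENNReal.ofReal_mul (by simp)]
    norm_num
  rw [h3, h4, one_mul]

lemma continuous_comp_sphereParam_projIcc
    (b : OrthonormalBasis (Fin 3) ℝ (EuclideanSpace ℝ (Fin 3)))
    {f : EuclideanSpace ℝ (Fin 3) → ℝ}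
    (hf : ContinuousOn f (Metric.sphere (0 : EuclideanSpace ℝ (Fin 3)) 1)) :
    Continuous fun p : ℝ × ℝ => f (sphereParam b
      (p.1, (Set.projIcc (-1 : ℝ) 1 (by norm_num) p.2 : ℝ))) := by
  refine hf.comp_continuous ?_ fun p => ?_
  · refine (continuous_sphereParam b).comp (continuous_fst.prodMk ?_)
    exact continuous_subtype_val.comp (continuous_projIcc.comp continuous_snd)
  · rw [mem_sphere_zero_iff_norm]
    exact norm_sphereParam b (Set.projIcc (-1 : ℝ) 1 (by norm_num) p.2).2

lemma circAvg_eq_integral_sphereParam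
    (b : OrthonormalBasis (Fin 3) ℝ (EuclideanSpace ℝ (Fin 3)))
    (f : EuclideanSpace ℝ (Fin 3) → ℝ) (t : ℝ) :
    circAvg f (b 0) (b 1) (b 2) t =
      (1 / (2 * π)) * ∫ s in (0 : ℝ)..(2 * π), f (sphereParam b (s, t)) := rfl

lemma circAvg_one (b : OrthonormalBasis (Fin 3) ℝ (EuclideanSpace ℝ (Fin 3)))
    (f : EuclideanSpace ℝ (Fin 3) → ℝ) : circAvg f (b 0) (b 1) (b 2) 1 = f (b 0) := by
  simp [circAvg, ← mul_assoc]

lemma continuousOn_circAvg (b : OrthonormalBasis (Fin 3) ℝ (EuclideanSpace ℝ (Fin 3)))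
    {f : EuclideanSpace ℝ (Fin 3) → ℝ}
    (hf : ContinuousOn f (Metric.sphere (0 : EuclideanSpace ℝ (Fin 3)) 1)) :
    ContinuousOn (circAvg f (b 0) (b 1) (b 2)) (Set.Icc (-1) 1) := by
  have h := continuous_comp_sphereParam_projIcc b hf
  have h2 : Continuous fun t : ℝ => (1 / (2 * π)) * ∫ s in (0 : ℝ)..(2 * π), f (sphereParam b
      (s, (Set.projIcc (-1 : ℝ) 1 (by norm_num) t : ℝ))) := by
    refine continuous_const.mul ?_
    exact intervalIntegral.continuous_parametric_intervalIntegral_of_continuous'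
      (f := fun t s => f (sphereParam b (s, (Set.projIcc (-1 : ℝ) 1 (by norm_num) t : ℝ))))
      (h.comp continuous_swap) _ _
  refine h2.continuousOn.congr fun t ht => ?_
  simp only [circAvg_eq_integral_sphereParam, Set.projIcc_of_mem _ ht]

/-- Slice integration over `S²`. -/
lemma integral_toSphere_eq_integral_circAvg
    (b : OrthonormalBasis (Fin 3) ℝ (EuclideanSpace ℝ (Fin 3)))
    {f : EuclideanSpace ℝ (Fin 3) → ℝ}
    (hf : ContinuousOn f (Metric.sphere (0 : EuclideanSpace ℝ (Fin 3)) 1)) :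
    ∫ y : Metric.sphere (0 : EuclideanSpace ℝ (Fin 3)) 1, f y
        ∂(volume : Measure (EuclideanSpace ℝ (Fin 3))).toSphere =
      2 * π * ∫ t in (-1 : ℝ)..1, circAvg f (b 0) (b 1) (b 2) t := by
  have hme : MeasurableEmbedding
      (Subtype.val : Metric.sphere (0 : EuclideanSpace ℝ (Fin 3)) 1 → _) :=
    MeasurableEmbedding.subtype_coe Metric.isClosed_sphere.measurableSet
  have hmap := map_toSphere_eq_map_sphereParam b
  have hcont := continuous_comp_sphereParam_projIcc b hf
  have hsm : AEStronglyMeasurable f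
      ((volume : Measure (EuclideanSpace ℝ (Fin 3))).toSphere.map Subtype.val) := by
    rw [hme.aestronglyMeasurable_map_iff]
    exact (continuousOn_iff_continuous_domRestrict.1 hf).aestronglyMeasurable
  rw [← hme.integral_map, hmap, integral_map (continuous_sphereParam b).aemeasurable (hmap ▸ hsm)]
  have hper : ∀ t : ℝ, ∫ s in Set.Ioo (-π) π, f (sphereParam b (s, t)) =
      2 * π * circAvg f (b 0) (b 1) (b 2) t := by
    intro t
    have hp : Function.Periodic (fun s => f (sphereParam b (s, t))) (2 * π) := by
      intro s
      simp [sphereParam]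
    have h := hp.intervalIntegral_add_eq (-π) 0
    rw [show -π + 2 * π = π by ring, zero_add] at h
    rw [circAvg_eq_integral_sphereParam, ← h,
      intervalIntegral.integral_of_le (by linarith [Real.pi_pos]), ← mul_assoc,
      mul_one_div_cancel (by positivity), one_mul,
      Measure.restrict_congr_set Ioo_ae_eq_Ioc]
  rw [integral_prod_symm]
  · simp_rw [hper]
    rw [integral_const_mul, intervalIntegral.integral_of_le (by norm_num),
      Measure.restrict_congr_set Ioo_ae_eq_Ioc]
  · rw [Measure.prod_restrict]
    have hK : IntegrableOn (fun p : ℝ × ℝ => f (sphereParam b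
        (p.1, (Set.projIcc (-1 : ℝ) 1 (by norm_num) p.2 : ℝ))))
        (Set.Ioo (-π) π ×ˢ Set.Ioo (-1 : ℝ) 1) :=
      (hcont.continuousOn.integrableOn_compact (isCompact_Icc.prod isCompact_Icc)).mono_set
        (Set.prod_mono Set.Ioo_subset_Icc_self Set.Ioo_subset_Icc_self)
    refine IntegrableOn.congr_fun hK (fun p hp => ?_) (measurableSet_Ioo.prod measurableSet_Ioo)
    rw [Set.projIcc_of_mem _ (Set.Ioo_subset_Icc_self hp.2)]

/-- The Funk–Hecke formula for the projection onto spherical harmonics. -/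
lemma sphHarmProj_eq_integral_circAvg
    (b : OrthonormalBasis (Fin 3) ℝ (EuclideanSpace ℝ (Fin 3)))
    {g : EuclideanSpace ℝ (Fin 3) → ℝ}
    (hg : ContinuousOn g (Metric.sphere (0 : EuclideanSpace ℝ (Fin 3)) 1)) (l : ℕ) :
    sphHarmProj l g (b 0) = (2 * (l : ℝ) + 1) / 2 *
      ∫ t in (-1 : ℝ)..1, (legendreP l).eval t * circAvg g (b 0) (b 1) (b 2) t := by
  have hcont : ContinuousOn (fun y => (legendreP l).eval (inner ℝ (b 0) y : ℝ) * g y)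
      (Metric.sphere (0 : EuclideanSpace ℝ (Fin 3)) 1) :=
    ContinuousOn.mul (Continuous.continuousOn
      ((legendreP l).continuous.comp (continuous_const.inner continuous_id))) hg
  have havg : ∀ t : ℝ, circAvg (fun y => (legendreP l).eval (inner ℝ (b 0) y : ℝ) * g y)
      (b 0) (b 1) (b 2) t = (legendreP l).eval t * circAvg g (b 0) (b 1) (b 2) t := by
    intro t
    simp only [circAvg_eq_integral_sphereParam, inner_sphereParam]
    rw [intervalIntegral.integral_const_mul]
    ring
  rw [sphHarmProj, integral_toSphere_eq_integral_circAvg b hcont]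
  simp_rw [havg]
  field_simp
  norm_num

namespace Polynomial

/-- Iterated integration by parts against a polynomial with high-order zeros at `±1`. -/
lemma integral_iterate_derivative_mul (W : ℝ[X]) :
    ∀ (k : ℕ) (q : ℝ[X]),
      (∀ j < k, (derivative^[j] W).eval 1 = 0 ∧ (derivative^[j] W).eval (-1) = 0) →
      ∫ t in (-1 : ℝ)..1, (derivative^[k] W).eval t * q.eval t =
        (-1) ^ k * ∫ t in (-1 : ℝ)..1, W.eval t * (derivative^[k] q).eval t := by
  intro k
  induction k with
  | zero => simp
  | succ k ih =>
    intro q h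
    have hparts := intervalIntegral.integral_deriv_mul_eq_sub
      (a := -1) (b := 1)
      (fun t _ => (derivative^[k] W).hasDerivAt t) (fun t _ => q.hasDerivAt t)
      ((derivative (derivative^[k] W)).continuous.intervalIntegrable _ _)
      ((derivative q).continuous.intervalIntegrable _ _)
    have h2 := h k (Nat.lt_succ_self k)
    rw [intervalIntegral.integral_add ((by fun_prop : Continuous _).intervalIntegrable _ _)
      ((by fun_prop : Continuous _).intervalIntegrable _ _),
      h2.1, h2.2, ih (derivative q) fun j hj => h j (hj.trans (Nat.lt_succ_self k))] at hparts
    rw [Function.iterate_succ_apply', Function.iterate_succ_apply]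
    linear_combination hparts

end Polynomial

open Polynomial in
lemma iterate_derivative_sq_sub_one_eval_eq_zero (n j : ℕ) (hj : j < n) :
    (derivative^[j] ((X ^ 2 - 1 : ℝ[X]) ^ n)).eval 1 = 0 ∧
      (derivative^[j] ((X ^ 2 - 1 : ℝ[X]) ^ n)).eval (-1) = 0 := by
  constructor
  · have := aeval_iterate_derivative_of_lt ((X ^ 2 - 1 : ℝ[X]) ^ n) n (1 : ℝ)
      (p' := (X + 1) ^ n) (by simp [← mul_pow]; ring) hj
    simpa using this
  · have := aeval_iterate_derivative_of_lt ((X ^ 2 - 1 : ℝ[X]) ^ n) n (-1 : ℝ)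
      (p' := (X - 1) ^ n) (by simp [← mul_pow]; ring) hj
    simpa using this

open Polynomial in
lemma legendreP_eval_one (n : ℕ) : (legendreP n).eval 1 = 1 := by
  have := aeval_iterate_derivative_self ((X ^ 2 - 1 : ℝ[X]) ^ n) n (1 : ℝ)
      (p' := (X + 1) ^ n) (by simp [← mul_pow]; ring)
  simp only [coe_aeval_eq_eval, eval_pow, eval_add, eval_X, eval_one, nsmul_eq_mul] at this
  rw [legendreP, eval_mul, this, eval_C]
  have := n.factorial_ne_zero
  field_simp
  norm_num

open Polynomial in
lemma legendreP_eval_neg_one (n : ℕ) : (legendreP n).eval (-1) = (-1) ^ n := by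
  have := aeval_iterate_derivative_self ((X ^ 2 - 1 : ℝ[X]) ^ n) n (-1 : ℝ)
      (p' := (X - 1) ^ n) (by simp [← mul_pow]; ring)
  simp only [coe_aeval_eq_eval, eval_pow, eval_sub, eval_X, eval_one, nsmul_eq_mul] at this
  rw [legendreP, eval_mul, this, eval_C]
  have := n.factorial_ne_zero
  field_simp
  rw [← mul_pow]
  norm_num

open Polynomial in
lemma natDegree_sq_sub_one_pow (n : ℕ) : ((X ^ 2 - 1 : ℝ[X]) ^ n).natDegree = n + n := by
  have h : (X ^ 2 - 1 : ℝ[X]) = X ^ 2 - C 1 := by simp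
  rw [natDegree_pow, h, natDegree_X_pow_sub_C]
  ring

lemma natDegree_legendreP_le (n : ℕ) : (legendreP n).natDegree ≤ n := by
  refine (Polynomial.natDegree_C_mul_le _ _).trans
    ((Polynomial.natDegree_iterate_derivative _ _).trans ?_)
  rw [natDegree_sq_sub_one_pow]
  omega

open Polynomial in
lemma coeff_legendreP_ne_zero (n : ℕ) : (legendreP n).coeff n ≠ 0 := by
  have hmonic : ((X ^ 2 - 1 : ℝ[X]) ^ n).Monic := by
    have h : (X ^ 2 - 1 : ℝ[X]) = X ^ 2 - C 1 := by simp
    rw [h]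
    exact (monic_X_pow_sub_C 1 two_ne_zero).pow n
  have h1 : ((X ^ 2 - 1 : ℝ[X]) ^ n).coeff (n + n) = 1 := by
    rw [← natDegree_sq_sub_one_pow]
    exact hmonic
  rw [legendreP, coeff_C_mul, coeff_iterate_derivative, h1]
  have h2 : (n + n).descFactorial n ≠ 0 := by
    rw [Ne, Nat.descFactorial_eq_zero_iff_lt]
    omega
  have := n.factorial_ne_zero
  simp [h2, this]

/-- Legendre polynomials are orthogonal to polynomials of lower degree. -/
lemma integral_legendreP_mul_eq_zero (n : ℕ) {q : Polynomial ℝ} (hq : q.degree < n) :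
    ∫ t in (-1 : ℝ)..1, (legendreP n).eval t * q.eval t = 0 := by
  have h := Polynomial.integral_iterate_derivative_mul ((Polynomial.X ^ 2 - 1) ^ n) n q
    (iterate_derivative_sq_sub_one_eval_eq_zero n)
  rw [Polynomial.iterate_derivative_eq_zero_of_degree_lt hq] at h
  simp only [Polynomial.eval_zero, mul_zero, intervalIntegral.integral_zero] at h
  simp only [legendreP, Polynomial.eval_mul, Polynomial.eval_C, mul_assoc]
  rw [intervalIntegral.integral_const_mul, h, mul_zero]

open Polynomial in
lemma integral_legendreP_sq (n : ℕ) :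
    (2 * (n : ℝ) + 1) * ∫ t in (-1 : ℝ)..1, (legendreP n).eval t * (legendreP n).eval t = 2 := by
  set P := legendreP n with hP
  set R : ℝ[X] := X * derivative P - C (n : ℝ) * P with hR
  have hRdeg : R.degree < n := by
    rw [degree_lt_iff_coeff_zero]
    intro j hj
    rcases j with _ | j
    · have : n = 0 := by omega
      simp [hR, this]
    · rw [hR, coeff_sub, coeff_X_mul, coeff_derivative, coeff_C_mul]
      rcases hj.lt_or_eq with h | h
      · rw [coeff_eq_zero_of_natDegree_lt ((natDegree_legendreP_le n).trans_lt h)]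
        simp
      · rw [h]
        push_cast
        ring
  have h0 := integral_legendreP_mul_eq_zero n hRdeg
  have hftc := intervalIntegral.integral_eq_sub_of_hasDerivAt (a := -1) (b := 1)
    (fun t _ => (X * P * P).hasDerivAt t)
    ((derivative (X * P * P)).continuous.intervalIntegrable _ _)
  have heq : ∀ t : ℝ, (derivative (X * P * P)).eval t =
      (2 * (n : ℝ) + 1) * (P.eval t * P.eval t) + 2 * (P.eval t * R.eval t) := by
    intro t
    simp [hR]
    ring
  simp_rw [heq] at hftc
  rw [intervalIntegral.integral_add ((by fun_prop : Continuous _).intervalIntegrable _ _)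
    ((by fun_prop : Continuous _).intervalIntegrable _ _),
    intervalIntegral.integral_const_mul, intervalIntegral.integral_const_mul, h0] at hftc
  simp only [eval_mul, eval_X, hP, legendreP_eval_one, legendreP_eval_neg_one] at hftc
  have h3 : ((-1 : ℝ) ^ n) * (-1) ^ n = 1 := by rw [← mul_pow]; simp
  linear_combination hftc + h3

/-- The kernel of the `m`-th partial sum of the Legendre expansion, evaluated at `1`. -/
noncomputable def legendreKernel (m : ℕ) : Polynomial ℝ :=
  ∑ l ∈ Finset.range (m + 1), Polynomial.C ((2 * (l : ℝ) + 1) / 2) * legendreP l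

lemma legendreKernel_eval (m : ℕ) (t : ℝ) : (legendreKernel m).eval t =
    ∑ l ∈ Finset.range (m + 1), (2 * (l : ℝ) + 1) / 2 * (legendreP l).eval t := by
  simp [legendreKernel, Polynomial.eval_finsetSum]

lemma natDegree_legendreKernel_le (m : ℕ) : (legendreKernel m).natDegree ≤ m := by
  refine Polynomial.natDegree_sum_le_of_forall_le _ _ fun l hl => ?_
  refine (Polynomial.natDegree_C_mul_le _ _).trans ((natDegree_legendreP_le l).trans ?_)
  have := Finset.mem_range.1 hl
  omega

lemma legendreKernel_eval_one (m : ℕ) : (legendreKernel m).eval 1 = ((m : ℝ) + 1) ^ 2 / 2 := by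
  simp only [legendreKernel_eval, legendreP_eval_one, mul_one]
  induction m with
  | zero => simp
  | succ m ih => rw [Finset.sum_range_succ, ih]; push_cast; ring

lemma integral_legendreKernel_mul_eq_sum (m : ℕ) {F : ℝ → ℝ}
    (hF : ContinuousOn F (Set.Icc (-1) 1)) :
    ∫ t in (-1 : ℝ)..1, (legendreKernel m).eval t * F t =
      ∑ l ∈ Finset.range (m + 1), (2 * (l : ℝ) + 1) / 2 *
        ∫ t in (-1 : ℝ)..1, (legendreP l).eval t * F t := by
  simp_rw [legendreKernel_eval, Finset.sum_mul, mul_assoc]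
  rw [intervalIntegral.integral_finsetSum]
  · simp_rw [intervalIntegral.integral_const_mul]
  · intro l _
    refine ContinuousOn.intervalIntegrable ?_
    rw [Set.uIcc_of_le (by norm_num)]
    exact continuousOn_const.mul ((legendreP l).continuous.continuousOn.mul hF)

lemma integral_legendreKernel_mul_legendreP {m j : ℕ} (hj : j ≤ m) :
    ∫ t in (-1 : ℝ)..1, (legendreKernel m).eval t * (legendreP j).eval t = 1 := by
  rw [integral_legendreKernel_mul_eq_sum m (legendreP j).continuous.continuousOn,
    Finset.sum_eq_single j]
  · linarith [integral_legendreP_sq j]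
  · intro l _ hlj
    rcases lt_or_gt_of_ne hlj with h | h
    · simp_rw [mul_comm (Polynomial.eval _ (legendreP l))]
      rw [integral_legendreP_mul_eq_zero j, mul_zero]
      exact Polynomial.degree_le_natDegree.trans_lt
        (by exact_mod_cast (natDegree_legendreP_le l).trans_lt h)
    · rw [integral_legendreP_mul_eq_zero l, mul_zero]
      exact Polynomial.degree_le_natDegree.trans_lt
        (by exact_mod_cast (natDegree_legendreP_le j).trans_lt h)
  · intro h
    exact absurd (Finset.mem_range.2 (Nat.lt_succ_of_le hj)) h

/-- The reproducing property of the Legendre kernel. -/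
lemma integral_legendreKernel_mul_eq_eval_one {m : ℕ} {p : Polynomial ℝ} (hp : p.natDegree ≤ m) :
    ∫ t in (-1 : ℝ)..1, (legendreKernel m).eval t * p.eval t = p.eval 1 := by
  have key : ∀ (n : ℕ), n ≤ m + 1 → ∀ p : Polynomial ℝ, p.degree < n →
      ∫ t in (-1 : ℝ)..1, (legendreKernel m).eval t * p.eval t = p.eval 1 := by
    intro n
    induction n with
    | zero =>
      intro _ p hp
      have : p = 0 := by simpa using hp
      simp [this]
    | succ n ih =>
      intro hn p hp
      set c := p.coeff n / (legendreP n).coeff n with hc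
      have hdeg : (p - Polynomial.C c * legendreP n).degree < n := by
        rw [Polynomial.degree_lt_iff_coeff_zero] at hp ⊢
        intro j hj
        rw [Polynomial.coeff_sub, Polynomial.coeff_C_mul]
        rcases hj.lt_or_eq with h | h
        · rw [hp j h, Polynomial.coeff_eq_zero_of_natDegree_lt
            ((natDegree_legendreP_le n).trans_lt h)]
          simp
        · rw [← h, hc, div_mul_cancel₀ _ (coeff_legendreP_ne_zero n), sub_self]
      have h := ih (by omega) _ hdeg
      have hPn := integral_legendreKernel_mul_legendreP (m := m) (j := n) (by omega)
      simp only [Polynomial.eval_sub, Polynomial.eval_mul, Polynomial.eval_C,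
        legendreP_eval_one, mul_sub, mul_left_comm _ c] at h
      rw [intervalIntegral.integral_sub ((by fun_prop : Continuous _).intervalIntegrable _ _)
        ((by fun_prop : Continuous _).intervalIntegrable _ _),
        intervalIntegral.integral_const_mul, hPn] at h
      linarith
  refine key (m + 1) le_rfl p (Polynomial.degree_le_natDegree.trans_lt ?_)
  exact_mod_cast Nat.lt_succ_of_le hp

/-- Bound on the Lebesgue constant at `1` of the Legendre expansion. -/
lemma integral_abs_legendreKernel_le (m : ℕ) :
    ∫ t in (-1 : ℝ)..1, |(legendreKernel m).eval t| ≤ m + 1 := by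
  have hc := (legendreKernel m).continuous
  have hm : (0 : ℝ) < m + 1 := by positivity
  have hle : ∀ t : ℝ, |(legendreKernel m).eval t| ≤
      ((legendreKernel m).eval t * (legendreKernel m).eval t) / (m + 1) + ((m : ℝ) + 1) / 4 := by
    intro t
    rw [← abs_mul_abs_self ((legendreKernel m).eval t)]
    set a := |(legendreKernel m).eval t|
    have : a * a / (m + 1) + ((m : ℝ) + 1) / 4 - a = (a - (m + 1) / 2) ^ 2 / (m + 1) := by
      field_simp
      ring
    have h2 : 0 ≤ (a - ((m : ℝ) + 1) / 2) ^ 2 / (m + 1) := by positivity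
    linarith
  calc ∫ t in (-1 : ℝ)..1, |(legendreKernel m).eval t|
      ≤ ∫ t in (-1 : ℝ)..1, (((legendreKernel m).eval t * (legendreKernel m).eval t) / (m + 1)
          + ((m : ℝ) + 1) / 4) :=
        intervalIntegral.integral_mono_on (by norm_num) (hc.abs.intervalIntegrable _ _)
          ((by fun_prop : Continuous _).intervalIntegrable _ _) fun t _ => hle t
    _ = m + 1 := by
        rw [intervalIntegral.integral_add ((by fun_prop : Continuous _).intervalIntegrable _ _)
          (by simp), intervalIntegral.integral_div,
          integral_legendreKernel_mul_eq_eval_one (natDegree_legendreKernel_le m),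
          legendreKernel_eval_one]
        simp
        field_simp
        ring

/-- The pointwise error at `1` of the truncated Legendre expansion, in terms of the error of
polynomial approximation. -/
lemma abs_sub_integral_legendreKernel_mul_le {m : ℕ} {F : ℝ → ℝ} {p : Polynomial ℝ} {ε : ℝ}
    (hF : ContinuousOn F (Set.Icc (-1) 1)) (hp : p.natDegree ≤ m)
    (hFp : ∀ t ∈ Set.Icc (-1 : ℝ) 1, |F t - p.eval t| ≤ ε) :
    |F 1 - ∫ t in (-1 : ℝ)..1, (legendreKernel m).eval t * F t| ≤ (m + 2) * ε := by
  have hK := (legendreKernel m).continuous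
  have hI : ∀ {G : ℝ → ℝ}, ContinuousOn G (Set.Icc (-1) 1) →
      IntervalIntegrable G volume (-1) 1 := fun hG =>
    ContinuousOn.intervalIntegrable (by rwa [Set.uIcc_of_le (by norm_num)])
  have hε : 0 ≤ ε := (abs_nonneg _).trans (hFp 1 (by norm_num))
  have hsplit : ∫ t in (-1 : ℝ)..1, (legendreKernel m).eval t * (F t - p.eval t) =
      (∫ t in (-1 : ℝ)..1, (legendreKernel m).eval t * F t) - p.eval 1 := by
    simp_rw [mul_sub]
    have h1 : IntervalIntegrable (fun t => (legendreKernel m).eval t * F t) volume (-1) 1 :=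
      hI (hK.continuousOn.mul hF)
    rw [intervalIntegral.integral_sub h1 ((by fun_prop : Continuous _).intervalIntegrable _ _),
      integral_legendreKernel_mul_eq_eval_one hp]
  have hbound : |∫ t in (-1 : ℝ)..1, (legendreKernel m).eval t * (F t - p.eval t)| ≤
      (m + 1) * ε := by
    calc |∫ t in (-1 : ℝ)..1, (legendreKernel m).eval t * (F t - p.eval t)|
        ≤ ∫ t in (-1 : ℝ)..1, |(legendreKernel m).eval t * (F t - p.eval t)| :=
          intervalIntegral.abs_integral_le_integral_abs (by norm_num)
      _ ≤ ∫ t in (-1 : ℝ)..1, |(legendreKernel m).eval t| * ε := by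
          refine intervalIntegral.integral_mono_on (by norm_num)
            (hI (hK.continuousOn.mul (hF.sub p.continuous.continuousOn)).abs)
            ((hK.abs.mul continuous_const).intervalIntegrable _ _) fun t ht => ?_
          rw [abs_mul]
          exact mul_le_mul_of_nonneg_left (hFp t ht) (abs_nonneg _)
      _ ≤ (m + 1) * ε := by
          rw [intervalIntegral.integral_mul_const]
          exact mul_le_mul_of_nonneg_right (integral_abs_legendreKernel_le m) hε
  have h1 := hFp 1 (by norm_num)
  rw [hsplit] at hbound
  rw [abs_le] at *
  constructor <;> linarith [h1.1, h1.2, hbound.1, hbound.2]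

lemma inv_sub_eq_geom_sum_add {z w : ℂ} (hz : z ≠ 0) (hzw : z - w ≠ 0) (n : ℕ) :
    (z - w)⁻¹ = ∑ k ∈ Finset.range n, w ^ k * (z ^ (k + 1))⁻¹ + w ^ n * (z ^ n)⁻¹ * (z - w)⁻¹ := by
  induction n with
  | zero => simp
  | succ n ih =>
    rw [Finset.sum_range_succ]
    conv_lhs => rw [ih]
    rw [add_assoc]
    congr 1
    field_simp
    ring

lemma norm_circleIntegral_sub_geom_sum_le {G : ℂ → ℂ} {ρ M C : ℝ} (hρ : 0 < ρ)
    (hG : ContinuousOn G (Metric.sphere 0 ρ)) (hM : ∀ z ∈ Metric.sphere (0 : ℂ) ρ, ‖G z‖ ≤ M)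
    {n : ℕ} {c : ℕ → ℂ} {φ : ℕ → ℂ → ℂ} {w : ℂ}
    (hφ : ∀ k, ContinuousOn (φ k) (Metric.sphere 0 ρ)) (hw : w ∉ Metric.sphere (0 : ℂ) ρ)
    (hC : ∀ z ∈ Metric.sphere (0 : ℂ) ρ,
      ‖(z - w)⁻¹ - ∑ k ∈ Finset.range n, c k * φ k z‖ ≤ C) :
    ‖(∮ z in C(0, ρ), (z - w)⁻¹ * G z) -
      ∑ k ∈ Finset.range n, c k * ∮ z in C(0, ρ), φ k z * G z‖ ≤ 2 * π * ρ * (C * M) := by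
  have hinv : ContinuousOn (fun z : ℂ => (z - w)⁻¹) (Metric.sphere 0 ρ) :=
    ContinuousOn.inv₀ (by fun_prop) fun z hz h => hw (sub_eq_zero.1 h ▸ hz)
  have hci : ∀ k ∈ Finset.range n, CircleIntegrable (fun z => c k * (φ k z * G z)) 0 ρ :=
    fun k _ => (continuousOn_const.mul ((hφ k).mul hG)).circleIntegrable hρ.le
  have hintG : CircleIntegrable (fun z => (z - w)⁻¹ * G z) 0 ρ :=
    (hinv.mul hG).circleIntegrable hρ.le
  have hintS : CircleIntegrable (fun z => ∑ k ∈ Finset.range n, c k * (φ k z * G z)) 0 ρ :=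
    (continuousOn_finsetSum _ fun k _ =>
      continuousOn_const.mul ((hφ k).mul hG)).circleIntegrable hρ.le
  have hsum : ∑ k ∈ Finset.range n, c k * ∮ z in C(0, ρ), φ k z * G z =
      ∮ z in C(0, ρ), ∑ k ∈ Finset.range n, c k * (φ k z * G z) := by
    rw [circleIntegral.integral_fun_sum hci]
    simp_rw [circleIntegral.integral_const_mul]
  rw [hsum, ← circleIntegral.integral_sub hintG hintS]
  refine circleIntegral.norm_integral_le_of_norm_le_const hρ.le fun z hz => ?_
  have : (z - w)⁻¹ * G z - ∑ k ∈ Finset.range n, c k * (φ k z * G z) =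
      ((z - w)⁻¹ - ∑ k ∈ Finset.range n, c k * φ k z) * G z := by
    rw [sub_mul, Finset.sum_mul]
    simp_rw [mul_assoc]
  rw [this, norm_mul]
  exact mul_le_mul (hC z hz) (hM z hz) (norm_nonneg _) ((norm_nonneg _).trans (hC z hz))

/-- Cauchy's integral formula on an annulus around the origin. -/
lemma circleIntegral_sub_circleIntegral_eq_of_annulus {G : ℂ → ℂ} {U : Set ℂ} {r R : ℝ} {w : ℂ}
    (hr : 0 < r) (hU : IsOpen U) (hG : DifferentiableOn ℂ G U)
    (hsub : Metric.closedBall 0 R \ Metric.ball 0 r ⊆ U) (hrw : r < ‖w‖) (hwR : ‖w‖ < R) :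
    (∮ z in C(0, R), (z - w)⁻¹ * G z) - (∮ z in C(0, r), (z - w)⁻¹ * G z) = 2 * π * Complex.I * G w := by
  have hmem : ∀ z : ℂ, r ≤ ‖z‖ → ‖z‖ ≤ R → z ∈ U := fun z h1 h2 =>
    hsub ⟨by simpa using h2, by simpa using h1⟩
  have hds : DifferentiableOn ℂ (dslope G w) U :=
    (Complex.differentiableOn_dslope (hU.mem_nhds (hmem w hrw.le hwR.le))).2 hG
  have hR : 0 < R := hr.trans (hrw.trans hwR)
  have hann := Complex.circleIntegral_eq_of_differentiable_on_annulus_off_countable hr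
    (hrw.trans hwR).le (s := ∅) Set.countable_empty (f := dslope G w) (hds.continuousOn.mono hsub)
    (fun z hz => hds.differentiableAt (hU.mem_nhds (hsub
      ⟨Metric.ball_subset_closedBall hz.1.1, fun h => hz.1.2 (Metric.ball_subset_closedBall h)⟩)))
  have hcirc : ∀ ρ : ℝ, 0 < ρ → r ≤ ρ → ρ ≤ R → ρ ≠ ‖w‖ →
      (∮ z in C(0, ρ), dslope G w z) = (∮ z in C(0, ρ), (z - w)⁻¹ * G z) -
        (∮ z in C(0, ρ), (z - w)⁻¹) * G w := by
    intro ρ hρ h1 h2 h3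
    have hne : ∀ z ∈ Metric.sphere (0 : ℂ) ρ, z ≠ w := by
      rintro z hz rfl
      exact h3 (mem_sphere_zero_iff_norm.1 hz).symm
    have hinv : ContinuousOn (fun z : ℂ => (z - w)⁻¹) (Metric.sphere 0 ρ) :=
      ContinuousOn.inv₀ (by fun_prop) fun z hz h => hne z hz (sub_eq_zero.1 h)
    have hGs : ContinuousOn G (Metric.sphere 0 ρ) := hG.continuousOn.mono fun z hz => by
      rw [mem_sphere_zero_iff_norm] at hz
      exact hmem z (hz ▸ h1) (hz ▸ h2)
    have hc : (∮ z in C(0, ρ), (z - w)⁻¹) * G w = ∮ z in C(0, ρ), (z - w)⁻¹ * G w := by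
      rw [mul_comm, ← circleIntegral.integral_const_mul]
      simp_rw [mul_comm (G w)]
    have hi₁ : CircleIntegrable (fun z => (z - w)⁻¹ * G z) 0 ρ :=
      (hinv.mul hGs).circleIntegrable hρ.le
    have hi₂ : CircleIntegrable (fun z => (z - w)⁻¹ * G w) 0 ρ :=
      (hinv.mul continuousOn_const).circleIntegrable hρ.le
    rw [hc, ← circleIntegral.integral_sub hi₁ hi₂]
    refine circleIntegral.integral_congr hρ.le fun z hz => ?_
    rw [dslope_of_ne _ (hne z hz), slope_def_field, div_eq_inv_mul]
    ring
  rw [hcirc R hR (hrw.trans hwR).le le_rfl hwR.ne',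
    hcirc r hr le_rfl (hrw.trans hwR).le hrw.ne,
    circleIntegral.integral_sub_inv_of_mem_ball (by simpa using hwR),
    Complex.circleIntegral_eq_zero_of_differentiable_on_off_countable hr.le
      (Set.countable_empty) (f := fun z => (z - w)⁻¹)] at hann
  · linear_combination hann
  · refine ContinuousOn.inv₀ (by fun_prop) fun z hz h => ?_
    rw [sub_eq_zero.1 h] at hz
    exact absurd (by simpa using hz) hrw.not_ge
  · rintro z ⟨hz, -⟩
    refine DifferentiableAt.inv (by fun_prop) fun h => ?_
    rw [sub_eq_zero.1 h] at hz
    exact absurd (by simpa using hz) hrw.not_gt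

/-- Truncation of the Laurent series of a function that is holomorphic and bounded on an annulus
symmetric about the unit circle. -/
lemma exists_laurent_truncation {G : ℂ → ℂ} {U : Set ℂ} {R M : ℝ} (hR : 1 < R) (hU : IsOpen U)
    (hG : DifferentiableOn ℂ G U) (hsub : Metric.closedBall 0 R \ Metric.ball 0 R⁻¹ ⊆ U)
    (hM : ∀ z : ℂ, ‖z‖ = R ∨ ‖z‖ = R⁻¹ → ‖G z‖ ≤ M) (m : ℕ) :
    ∃ a b : ℕ → ℂ, ∀ w : ℂ, ‖w‖ = 1 →
      ‖G w - (∑ k ∈ Finset.range (m + 1), a k * w ^ k +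
        ∑ k ∈ Finset.range m, b k * w⁻¹ ^ (k + 1))‖ ≤ 2 * (M / (R ^ m * (R - 1))) := by
  have hR0 : 0 < R := one_pos.trans hR
  have hRi : 0 < R⁻¹ := inv_pos.2 hR0
  have hRi1 : R⁻¹ < 1 := inv_lt_one_of_one_lt₀ hR
  have hmem : ∀ z : ℂ, R⁻¹ ≤ ‖z‖ → ‖z‖ ≤ R → z ∈ U := fun z h1 h2 =>
    hsub ⟨by simpa using h2, by simpa using h1⟩
  have hpi : 2 * (π : ℂ) * Complex.I ≠ 0 := by simp [Real.pi_ne_zero]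
  set a : ℕ → ℂ := fun k =>
    (2 * π * Complex.I)⁻¹ * ∮ z in C(0, R), (z ^ (k + 1))⁻¹ * G z with ha
  set b : ℕ → ℂ := fun k =>
    (2 * π * Complex.I)⁻¹ * ∮ z in C(0, R⁻¹), z ^ k * G z with hb
  refine ⟨a, b, fun w hw => ?_⟩
  have hw0 : w ≠ 0 := fun h => by simp [h] at hw
  have hcauchy := circleIntegral_sub_circleIntegral_eq_of_annulus hRi hU hG hsub
    (w := w) (by rwa [hw]) (by rwa [hw])
  have hlow : ∀ z : ℂ, |‖z‖ - 1| ≤ ‖z - w‖ := fun z => by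
    have := abs_norm_sub_norm_le z w
    rwa [hw] at this
  have hout := norm_circleIntegral_sub_geom_sum_le (G := G) (M := M)
    (C := (R ^ (m + 1))⁻¹ * (R - 1)⁻¹) hR0
    (hG.continuousOn.mono fun z hz => by
      rw [mem_sphere_zero_iff_norm] at hz
      exact hmem z (by rw [hz]; linarith) hz.le)
    (fun z hz => hM z (Or.inl (by simpa using hz))) (n := m + 1) (c := fun k => w ^ k)
    (φ := fun k z => (z ^ (k + 1))⁻¹) (w := w)
    (fun k => ContinuousOn.inv₀ (by fun_prop) fun z hz => by
      refine pow_ne_zero _ (norm_ne_zero_iff.1 ?_)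
      rw [mem_sphere_zero_iff_norm.1 hz]
      exact hR0.ne')
    (by rw [mem_sphere_zero_iff_norm, hw]; exact hR.ne)
    (fun z hz => by
      rw [mem_sphere_zero_iff_norm] at hz
      have hz0 : z ≠ 0 := norm_ne_zero_iff.1 (by rw [hz]; exact hR0.ne')
      have hd : R - 1 ≤ ‖z - w‖ := by
        have := (le_abs_self _).trans (hlow z)
        rwa [hz] at this
      have hd0 : z - w ≠ 0 := norm_ne_zero_iff.1 (by linarith)
      rw [sub_eq_of_eq_add' (inv_sub_eq_geom_sum_add hz0 hd0 (m + 1)), norm_mul, norm_mul,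
        norm_pow, hw, one_pow, one_mul, norm_inv, norm_inv, norm_pow, hz]
      gcongr)
  have hinn := norm_circleIntegral_sub_geom_sum_le (G := G) (M := M)
    (C := (R⁻¹) ^ m * (1 - R⁻¹)⁻¹) hRi
    (hG.continuousOn.mono fun z hz => by
      rw [mem_sphere_zero_iff_norm] at hz
      exact hmem z hz.ge (by rw [hz]; linarith))
    (fun z hz => hM z (Or.inr (by simpa using hz))) (n := m) (c := fun k => -w⁻¹ ^ (k + 1))
    (φ := fun k z => z ^ k) (w := w) (fun k => by fun_prop)
    (by rw [mem_sphere_zero_iff_norm, hw]; exact hRi1.ne')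
    (fun z hz => by
      rw [mem_sphere_zero_iff_norm] at hz
      have hd : 1 - R⁻¹ ≤ ‖z - w‖ := by
        have := (neg_le_abs _).trans (hlow z)
        rw [hz] at this
        linarith
      have hd0 : w - z ≠ 0 := by
        rw [← neg_sub, neg_ne_zero, ← norm_ne_zero_iff]
        linarith
      have hid := inv_sub_eq_geom_sum_add hw0 hd0 m
      have : (z - w)⁻¹ - ∑ k ∈ Finset.range m, -w⁻¹ ^ (k + 1) * z ^ k =
          -(z ^ m * (w ^ m)⁻¹ * (w - z)⁻¹) := by
        have hT : ∑ k ∈ Finset.range m, -w⁻¹ ^ (k + 1) * z ^ k =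
            -∑ k ∈ Finset.range m, z ^ k * (w ^ (k + 1))⁻¹ := by
          rw [← Finset.sum_neg_distrib]
          exact Finset.sum_congr rfl fun k _ => by rw [inv_pow]; ring
        rw [← neg_sub w z, inv_neg, hT]
        linear_combination -hid
      rw [this, norm_neg, norm_mul, norm_mul, norm_pow, norm_inv, norm_inv, norm_pow, hw, hz,
        one_pow, inv_one, mul_one, norm_sub_rev]
      gcongr)
  set I₁ := ∮ z in C(0, R), (z - w)⁻¹ * G z
  set I₂ := ∮ z in C(0, R⁻¹), (z - w)⁻¹ * G z
  set S₁ := ∑ k ∈ Finset.range (m + 1), w ^ k * ∮ z in C(0, R), (z ^ (k + 1))⁻¹ * G z with hS₁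
  set S₂ := ∑ k ∈ Finset.range m, -w⁻¹ ^ (k + 1) * ∮ z in C(0, R⁻¹), z ^ k * G z with hS₂
  have hsplit : G w - (∑ k ∈ Finset.range (m + 1), a k * w ^ k +
      ∑ k ∈ Finset.range m, b k * w⁻¹ ^ (k + 1)) =
      (2 * π * Complex.I)⁻¹ * ((I₁ - S₁) - (I₂ - S₂)) := by
    have e1 : ∑ k ∈ Finset.range (m + 1), a k * w ^ k = (2 * π * Complex.I)⁻¹ * S₁ := by
      rw [hS₁, Finset.mul_sum]
      exact Finset.sum_congr rfl fun k _ => by rw [ha]; ring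
    have e2 : ∑ k ∈ Finset.range m, b k * w⁻¹ ^ (k + 1) = -((2 * π * Complex.I)⁻¹ * S₂) := by
      rw [hS₂, Finset.mul_sum, ← Finset.sum_neg_distrib]
      exact Finset.sum_congr rfl fun k _ => by rw [hb]; ring
    have e3 : G w = (2 * π * Complex.I)⁻¹ * (I₁ - I₂) := by
      rw [hcauchy, inv_mul_cancel_left₀ hpi]
    rw [e1, e2, e3]
    ring
  have hnorm : ‖(2 * (π : ℂ) * Complex.I)⁻¹‖ = (2 * π)⁻¹ := by
    simp [abs_of_pos Real.pi_pos]
  rw [hsplit, norm_mul, hnorm]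
  have hR1 : R - 1 ≠ 0 := by linarith
  calc (2 * π)⁻¹ * ‖(I₁ - S₁) - (I₂ - S₂)‖
      ≤ (2 * π)⁻¹ * (2 * π * R * ((R ^ (m + 1))⁻¹ * (R - 1)⁻¹ * M) +
          2 * π * R⁻¹ * ((R⁻¹) ^ m * (1 - R⁻¹)⁻¹ * M)) := by
        gcongr
        exact (norm_sub_le _ _).trans (add_le_add hout hinn)
    _ = 2 * (M / (R ^ m * (R - 1))) := by
        have e : 1 - R⁻¹ = (R - 1) / R := by field_simp
        rw [e, inv_pow]
        field_simp
        ring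

/-- Polynomial approximation on `[-1, 1]` of a function `h` whose composition with the Joukowski
map is holomorphic on an annulus. -/
lemma exists_polynomial_approx_of_joukowski {h : ℂ → ℂ} {U : Set ℂ} {R M : ℝ} (hR : 1 < R)
    (hU : IsOpen U) (hh : DifferentiableOn ℂ (fun z => h ((z + z⁻¹) / 2)) U)
    (hsub : Metric.closedBall 0 R \ Metric.ball 0 R⁻¹ ⊆ U)
    (hM : ∀ z : ℂ, ‖z‖ = R ∨ ‖z‖ = R⁻¹ → ‖h ((z + z⁻¹) / 2)‖ ≤ M) (m : ℕ) :
    ∃ p : Polynomial ℝ, p.natDegree ≤ m ∧ ∀ t ∈ Set.Icc (-1 : ℝ) 1,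
      |(h t).re - p.eval t| ≤ 2 * (M / (R ^ m * (R - 1))) := by
  obtain ⟨a, b, hab⟩ := exists_laurent_truncation hR hU hh hsub hM m
  refine ⟨∑ k ∈ Finset.range (m + 1), Polynomial.C (a k).re * Polynomial.Chebyshev.T ℝ k +
    ∑ k ∈ Finset.range m, Polynomial.C (b k).re * Polynomial.Chebyshev.T ℝ (k + 1 : ℕ), ?_, ?_⟩
  · refine Polynomial.natDegree_add_le_of_degree_le
      (Polynomial.natDegree_sum_le_of_forall_le _ _ fun k hk => ?_)
      (Polynomial.natDegree_sum_le_of_forall_le _ _ fun k hk => ?_)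
    · refine (Polynomial.natDegree_C_mul_le _ _).trans ?_
      rw [Polynomial.Chebyshev.natDegree_T]
      have := Finset.mem_range.1 hk
      omega
    · refine (Polynomial.natDegree_C_mul_le _ _).trans ?_
      rw [Polynomial.Chebyshev.natDegree_T]
      have := Finset.mem_range.1 hk
      omega
  · intro t ht
    set θ := Real.arccos t
    have hcos : Real.cos θ = t := Real.cos_arccos ht.1 ht.2
    set w := Complex.exp (θ * Complex.I) with hw
    have hwinv : w⁻¹ = Complex.exp (-(θ * Complex.I)) := by rw [hw, Complex.exp_neg]
    have hw1 : ‖w‖ = 1 := Complex.norm_exp_ofReal_mul_I θ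
    have hJ : (w + w⁻¹) / 2 = (t : ℂ) := by
      rw [hwinv, hw, ← hcos, Complex.ofReal_cos, Complex.cos, neg_mul]
    have hpow : ∀ k : ℕ, w ^ k + w⁻¹ ^ k = ((2 * Real.cos (k * θ) : ℝ) : ℂ) := by
      intro k
      rw [hwinv, hw, ← Complex.exp_nat_mul, ← Complex.exp_nat_mul]
      push_cast
      rw [Complex.cos]
      ring_nf
    have h1 := hab w hw1
    have h2 := hab w⁻¹ (by rw [norm_inv, hw1, inv_one])
    simp only [inv_inv] at h2
    rw [add_comm w⁻¹ w] at h2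
    rw [hJ] at h1 h2
    set ε := 2 * (M / (R ^ m * (R - 1)))
    have hsum : ∀ (n j : ℕ) (c : ℕ → ℂ),
        (∑ k ∈ Finset.range n, c k * w ^ (k + j) + ∑ k ∈ Finset.range n, c k * w⁻¹ ^ (k + j)).re =
          2 * ∑ k ∈ Finset.range n, (c k).re * Real.cos ((k + j : ℕ) * θ) := by
      intro n j c
      rw [← Finset.sum_add_distrib, Complex.re_sum, Finset.mul_sum]
      refine Finset.sum_congr rfl fun k _ => ?_
      rw [← mul_add, hpow, Complex.re_mul_ofReal]
      ring
    have hs1 := hsum (m + 1) 0 a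
    have hs2 := hsum m 1 b
    simp only [add_zero] at hs1
    have heval : (∑ k ∈ Finset.range (m + 1), Polynomial.C (a k).re * Polynomial.Chebyshev.T ℝ k +
        ∑ k ∈ Finset.range m, Polynomial.C (b k).re *
          Polynomial.Chebyshev.T ℝ (k + 1 : ℕ)).eval t =
        ∑ k ∈ Finset.range (m + 1), (a k).re * Real.cos (k * θ) +
        ∑ k ∈ Finset.range m, (b k).re * Real.cos ((k + 1 : ℕ) * θ) := by
      rw [← hcos]
      simp only [Polynomial.eval_add, Polynomial.eval_finsetSum, Polynomial.eval_mul,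
        Polynomial.eval_C, Polynomial.Chebyshev.T_real_cos, Int.cast_natCast]
    rw [heval]
    have h3 := (Complex.abs_re_le_norm _).trans h1
    have h4 := (Complex.abs_re_le_norm _).trans h2
    simp only [Complex.sub_re, Complex.add_re] at h3 h4 hs1 hs2
    rw [abs_le] at *
    constructor <;> linarith [h3.1, h3.2, h4.1, h4.2]

lemma re_im_cosh (ζ : ℂ) : (Complex.cosh ζ).re = Real.cosh ζ.re * Real.cos ζ.im ∧
    (Complex.cosh ζ).im = Real.sinh ζ.re * Real.sin ζ.im := by
  have h : Complex.cosh ζ = (Real.cosh ζ.re * Real.cos ζ.im : ℝ) +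
      (Real.sinh ζ.re * Real.sin ζ.im : ℝ) * Complex.I := by
    conv_lhs => rw [← Complex.re_add_im ζ]
    rw [Complex.cosh_add, Complex.cosh_mul_I, Complex.sinh_mul_I]
    push_cast
    ring
  rw [h]
  simp [-Complex.ofReal_mul]

lemma cosh_mem_ellipseBoundary {r : ℝ} (hr : r ≠ 0) {ζ : ℂ} (hζ : |ζ.re| = |r|) :
    Complex.cosh ζ ∈ ellipseBoundary r := by
  have hc : Real.cosh ζ.re ^ 2 = Real.cosh r ^ 2 := by
    rw [← Real.cosh_abs ζ.re, hζ, Real.cosh_abs]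
  have hs : Real.sinh ζ.re ^ 2 = Real.sinh r ^ 2 := by
    rw [← sq_abs, Real.abs_sinh, hζ, ← Real.abs_sinh, sq_abs]
  have hc0 : Real.cosh r ^ 2 ≠ 0 := pow_ne_zero _ (Real.cosh_pos r).ne'
  have hs0 : Real.sinh r ^ 2 ≠ 0 := pow_ne_zero _ (Real.sinh_eq_zero.not.2 hr)
  change (Complex.cosh ζ).re ^ 2 / _ + (Complex.cosh ζ).im ^ 2 / _ = 1
  rw [(re_im_cosh ζ).1, (re_im_cosh ζ).2, mul_pow, mul_pow, hc, hs, mul_div_cancel_left₀ _ hc0,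
    mul_div_cancel_left₀ _ hs0, Real.cos_sq_add_sin_sq]

lemma cosh_mem_ellipseClosed {b : ℝ} (hb : b ≠ 0) {ζ : ℂ} (hζ : |ζ.re| ≤ |b|) :
    Complex.cosh ζ ∈ ellipseClosed b := by
  have hc : Real.cosh ζ.re ^ 2 ≤ Real.cosh b ^ 2 :=
    pow_le_pow_left₀ (Real.cosh_pos _).le (Real.cosh_le_cosh.2 hζ) 2
  have hs : Real.sinh ζ.re ^ 2 ≤ Real.sinh b ^ 2 := by
    rw [sq_le_sq, Real.abs_sinh, Real.abs_sinh]
    exact Real.sinh_le_sinh.2 hζ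
  have hc0 : 0 < Real.cosh b ^ 2 := pow_pos (Real.cosh_pos b) _
  have hs0 : 0 < Real.sinh b ^ 2 := sq_pos_of_ne_zero (Real.sinh_eq_zero.not.2 hb)
  change (Complex.cosh ζ).re ^ 2 / _ + (Complex.cosh ζ).im ^ 2 / _ ≤ 1
  rw [(re_im_cosh ζ).1, (re_im_cosh ζ).2, mul_pow, mul_pow, ← Real.cos_sq_add_sin_sq ζ.im]
  refine add_le_add ((div_le_iff₀ hc0).2 ?_) ((div_le_iff₀ hs0).2 ?_)
  · rw [mul_comm]
    gcongr
  · rw [mul_comm]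
    gcongr

lemma joukowski_eq_cosh_log {z : ℂ} (hz : z ≠ 0) :
    (z + z⁻¹) / 2 = Complex.cosh (Complex.log z) := by
  rw [Complex.cosh, Complex.exp_neg, Complex.exp_log hz]

lemma memAlambdaSphere.nonneg {lam : ℝ → EReal} {g : EuclideanSpace ℝ (Fin 3) → ℝ} {Ng : ℝ}
    (hN : memAlambdaSphere lam g Ng) {r : ℝ} (hr : 0 < r) (hrB : (r : EReal) < Blam lam) :
    0 ≤ Ng := by
  have hb := (EuclideanSpace.basisFun (Fin 3) ℝ).orthonormal
  obtain ⟨h, -, -, hbd⟩ := hN _ _ _ (hb.1 0) (hb.1 1) (hb.1 2)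
    (hb.2 (by decide)) (hb.2 (by decide)) (hb.2 (by decide))
  exact (by positivity : (0 : ℝ) ≤ _).trans
    (hbd r hr hrB (Complex.cosh r) (cosh_mem_ellipseBoundary hr.ne' (by simp)))

lemma abs_sub_sum_sphHarmProj_le {lam : ℝ → EReal} {g : EuclideanSpace ℝ (Fin 3) → ℝ}
    (hg : ContinuousOn g (Metric.sphere (0 : EuclideanSpace ℝ (Fin 3)) 1)) {Ng : ℝ}
    (hN : memAlambdaSphere lam g Ng) {r : ℝ} (hr : 0 < r) (hrB : (r : EReal) < Blam lam) (m : ℕ)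
    {x : EuclideanSpace ℝ (Fin 3)} (hx : x ∈ Metric.sphere (0 : EuclideanSpace ℝ (Fin 3)) 1) :
    |g x - ∑ l ∈ Finset.range (m + 1), sphHarmProj l g x| ≤
      (m + 2) * (2 * (Real.exp (lam r).toReal * Ng / (Real.exp r ^ m * (Real.exp r - 1)))) := by
  have hon : Orthonormal ℝ (({0} : Set (Fin 3)).domRestrict fun _ : Fin 3 => x) :=
    ⟨fun _ => mem_sphere_zero_iff_norm.1 hx,
      fun i j hij => absurd (Subsingleton.elim i j) hij⟩
  obtain ⟨b, hb⟩ := hon.exists_orthonormalBasis_extension_of_card_eq (by simp)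
  obtain rfl : b 0 = x := hb 0 rfl
  obtain ⟨h, hdiff, heq, hbd⟩ := hN _ _ _ (b.orthonormal.1 0) (b.orthonormal.1 1)
    (b.orthonormal.1 2) (b.orthonormal.2 (by decide)) (b.orthonormal.2 (by decide))
    (b.orthonormal.2 (by decide))
  obtain ⟨ρ, hrρ, hρB⟩ := EReal.lt_iff_exists_real_btwn.1 hrB
  rw [EReal.coe_lt_coe_iff] at hrρ
  have hρ : 0 < ρ := hr.trans hrρ
  have hpos : ∀ z ∈ {z : ℂ | Real.exp (-ρ) < ‖z‖ ∧ ‖z‖ < Real.exp ρ}, 0 < ‖z‖ :=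
    fun z hz => (Real.exp_pos _).trans hz.1
  have hmaps : Set.MapsTo (fun z : ℂ => (z + z⁻¹) / 2)
      {z : ℂ | Real.exp (-ρ) < ‖z‖ ∧ ‖z‖ < Real.exp ρ} (ellipseRegion lam) := by
    intro z hz
    have hz0 := hpos z hz
    refine ⟨ρ, hρ, hρB, ?_⟩
    change (z + z⁻¹) / 2 ∈ _
    rw [joukowski_eq_cosh_log (norm_pos_iff.1 hz0)]
    refine cosh_mem_ellipseClosed hρ.ne' ?_
    rw [Complex.log_re, abs_of_pos hρ, abs_le]
    exact ⟨((Real.lt_log_iff_exp_lt hz0).2 hz.1).le, ((Real.log_lt_iff_lt_exp hz0).2 hz.2).le⟩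
  obtain ⟨p, hp, hpt⟩ := exists_polynomial_approx_of_joukowski (h := h)
    (M := Real.exp (lam r).toReal * Ng) (Real.one_lt_exp_iff.2 hr)
    ((isOpen_lt continuous_const continuous_norm).inter
      (isOpen_lt continuous_norm continuous_const))
    (hdiff.comp (fun z hz => DifferentiableAt.differentiableWithinAt (by
      have := norm_pos_iff.1 (hpos z hz)
      fun_prop (disch := assumption))) hmaps)
    (fun z hz => by
      have h1 : ‖z‖ ≤ Real.exp r := by simpa using hz.1
      have h2 : Real.exp (-r) ≤ ‖z‖ := by simpa [Real.exp_neg] using hz.2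
      exact ⟨(Real.exp_lt_exp.2 (neg_lt_neg hrρ)).trans_le h2,
        h1.trans_lt (Real.exp_lt_exp.2 hrρ)⟩)
    (fun z hz => by
      have hz0 : z ≠ 0 := by
        rintro rfl
        rw [norm_zero] at hz
        rcases hz with hz | hz
        · exact (Real.exp_pos r).ne hz
        · exact (inv_pos.2 (Real.exp_pos r)).ne hz
      have hlog : |(Complex.log z).re| = |r| := by
        rw [Complex.log_re]
        rcases hz with hz | hz <;> simp [hz]
      rw [joukowski_eq_cosh_log hz0]
      have := hbd r hr hrB _ (cosh_mem_ellipseBoundary hr.ne' hlog)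
      rwa [Real.exp_neg, inv_mul_le_iff₀ (Real.exp_pos _)] at this) m
  have hF := continuousOn_circAvg b hg
  have hcl : ∀ t ∈ Set.Icc (-1 : ℝ) 1, |circAvg g (b 0) (b 1) (b 2) t - p.eval t| ≤
      2 * (Real.exp (lam r).toReal * Ng / (Real.exp r ^ m * (Real.exp r - 1))) := by
    intro t ht
    rw [← closure_Ioo (by norm_num : (-1 : ℝ) ≠ 1)] at ht hF
    refine le_on_closure (fun s hs => ?_) ((hF.sub p.continuous.continuousOn).abs)
      continuousOn_const ht
    have := hpt s (Set.Ioo_subset_Icc_self hs)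
    rwa [heq s hs, Complex.ofReal_re] at this
  have := abs_sub_integral_legendreKernel_mul_le hF hp hcl
  rw [integral_legendreKernel_mul_eq_sum m hF, circAvg_one] at this
  simpa only [sphHarmProj_eq_integral_circAvg b hg] using this

/-- Exponential approximation rate of the truncated spherical harmonics
expansion for functions in `A^λ(S²)` (Theorem 3.7, part 3): there are `c_λ, d_λ > 0` and
`m₀ ∈ ℕ` with `‖g - S_m g‖_{L^∞(S²)} ≤ (c_λ + m d_λ) exp(-λ*(m)) ‖g‖_{A^λ(S²)}`
for all `m ≥ m₀`. -/
theorem spherical_harmonics_truncation_error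
    (lam : ℝ → EReal) (hlam_bot : ∀ r, lam r ≠ ⊥)
    (hlam_mono : MonotoneOn lam (Set.Ici 0))
    (hBpos : 0 < Blam lam) :
    ∃ (c d : ℝ) (m₀ : ℕ), 0 < c ∧ 0 < d ∧
      ∀ (g : EuclideanSpace ℝ (Fin 3) → ℝ),
        ContinuousOn g (Metric.sphere (0 : EuclideanSpace ℝ (Fin 3)) 1) →
      ∀ (Ng : ℝ), memAlambdaSphere lam g Ng →
      ∀ (m : ℕ), m₀ ≤ m →
      ∀ x ∈ Metric.sphere (0 : EuclideanSpace ℝ (Fin 3)) 1,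
        |g x - ∑ l ∈ Finset.range (m + 1), sphHarmProj l g x|
          ≤ (c + (m : ℝ) * d) * expNegLamStar lam m * Ng := by
  obtain ⟨-, ⟨r₀, -, hr₀top, rfl⟩, hr₀⟩ := lt_sSup_iff.1 hBpos
  rw [EReal.coe_pos] at hr₀
  have hle : ∀ {r : ℝ}, 0 ≤ r → lam r ≠ ⊤ → (r : EReal) ≤ Blam lam := fun h1 h2 =>
    le_sSup ⟨_, h1, h2, rfl⟩
  have hmono : ∀ {s t : ℝ}, 0 ≤ s → s ≤ t → lam t ≠ ⊤ → (lam s).toReal ≤ (lam t).toReal :=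
    fun hs hst ht => EReal.toReal_le_toReal
      (hlam_mono (Set.mem_Ici.2 hs) (Set.mem_Ici.2 (hs.trans hst)) hst) (hlam_bot _) ht
  set ρ := r₀ / 2 with hρdef
  have hρ : 0 < ρ := half_pos hr₀
  have hρr₀ : ρ < r₀ := half_lt_self hr₀
  have hE : 0 < Real.exp ρ - 1 := sub_pos.2 (Real.one_lt_exp_iff.2 hρ)
  refine ⟨4 / (Real.exp ρ - 1), 2 / (Real.exp ρ - 1),
    ⌈((lam r₀).toReal - (lam 0).toReal) / ρ⌉₊, by positivity, by positivity, ?_⟩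
  intro g hg Ng hN m hm x hx
  have hNg : 0 ≤ Ng := hN.nonneg hρ
    ((EReal.coe_lt_coe_iff.2 hρr₀).trans_le (hle hr₀.le hr₀top))
  set K := 4 / (Real.exp ρ - 1) + (m : ℝ) * (2 / (Real.exp ρ - 1)) with hK
  have hK0 : 0 < K := by positivity
  have hlarge : ∀ r : ℝ, ρ < r → lam r ≠ ⊤ →
      |g x - ∑ l ∈ Finset.range (m + 1), sphHarmProj l g x| ≤
        K * Real.exp ((lam r).toReal - m * r) * Ng := by
    intro r hr hrtop
    have htend : Filter.Tendsto (fun t : ℝ => K * Real.exp ((lam r).toReal - m * t) * Ng)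
        (nhdsWithin r (Set.Iio r)) (nhds (K * Real.exp ((lam r).toReal - m * r) * Ng)) :=
      (Continuous.tendsto (by fun_prop) r).mono_left nhdsWithin_le_nhds
    refine ge_of_tendsto htend ?_
    filter_upwards [Ioo_mem_nhdsLT hr] with t ht
    have ht0 : 0 < t := hρ.trans ht.1
    refine (abs_sub_sum_sphHarmProj_le hg hN ht0 ((EReal.coe_lt_coe_iff.2 ht.2).trans_le
      (hle (hρ.trans hr).le hrtop)) m hx).trans ?_
    calc ((m : ℝ) + 2) * (2 * (Real.exp (lam t).toReal * Ng /
          (Real.exp t ^ m * (Real.exp t - 1))))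
        ≤ (m + 2) * (2 * (Real.exp (lam r).toReal * Ng / (Real.exp t ^ m * (Real.exp ρ - 1)))) := by
          gcongr
          · exact hmono ht0.le ht.2.le hrtop
          · exact ht.1.le
      _ = K * Real.exp ((lam r).toReal - m * t) * Ng := by
          rw [hK, Real.exp_sub, Real.exp_nat_mul]
          field_simp
          ring
  have hall : ∀ r : ℝ, 0 ≤ r → lam r ≠ ⊤ →
      |g x - ∑ l ∈ Finset.range (m + 1), sphHarmProj l g x| ≤
        K * Real.exp ((lam r).toReal - m * r) * Ng := by
    intro r hr hrtop
    rcases lt_or_ge ρ r with h | h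
    · exact hlarge r h hrtop
    · refine (hlarge r₀ hρr₀ hr₀top).trans ?_
      have h0 := hmono le_rfl hr hrtop
      have hm' : (lam r₀).toReal - (lam 0).toReal ≤ m * ρ :=
        (div_le_iff₀ hρ).1 (Nat.ceil_le.1 hm)
      have hmr : (m : ℝ) * r ≤ m * ρ := by gcongr
      have hm2 : (m : ℝ) * r₀ = m * ρ + m * ρ := by rw [hρdef]; ring
      have hexp : (lam r₀).toReal - m * r₀ ≤ (lam r).toReal - m * r := by linarith
      gcongr K * ?_ * Ng
      exact Real.exp_le_exp.2 hexp
  have hinf : |g x - ∑ l ∈ Finset.range (m + 1), sphHarmProj l g x| ≤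
      K * Ng * expNegLamStar lam m := by
    rcases hNg.eq_or_lt with h | h
    · simpa [← h] using hall r₀ hr₀.le hr₀top
    · rw [← div_le_iff₀' (by positivity)]
      refine le_csInf ⟨_, r₀, hr₀.le, hr₀top, rfl⟩ ?_
      rintro y ⟨r, hr, hrtop, rfl⟩
      rw [div_le_iff₀' (by positivity)]
      exact (hall r hr hrtop).trans_eq (by ring)
  exact hinf.trans_eq (by ring)
end

section
/- There exists δ₀ > 0 and constants c_λ, d_λ > 0 (depending only on λ) such that for every g ∈ A^λ(S²) and every 0 < δ ≤ δ₀: ‖g‖_{L∞(S²)} ≤ (c_λ + √(4π/δ)·d_λ)·exp(−λ*(⌊√(4π/δ)⌋ − 1))·‖g‖_{A^λ(S²)} + (1/δ)·‖g‖_{L¹(S²)}. -/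
open scoped Real ENNReal
open MeasureTheory

/-- Three-dimensional Euclidean space. -/
abbrev E3 := EuclideanSpace ℝ (Fin 3)

theorem lintegral_ball_eq_toSphere (F : E3 → ℝ≥0∞) (hF : Measurable F) :
    ∫⁻ y : E3, (if ‖y‖ < 1 then F (‖y‖⁻¹ • y) else 0)
      = ENNReal.ofReal (1 / 3) *
        ∫⁻ y : Metric.sphere (0 : E3) 1, F y ∂(volume : Measure E3).toSphere := by
  have h1 : Measurable fun y : E3 => (if ‖y‖ < 1 then F (‖y‖⁻¹ • y) else 0) := by
    refine Measurable.ite (measurableSet_lt (by fun_prop) (by fun_prop)) ?_ (by fun_prop)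
    exact hF.comp (by fun_prop)
  have h2 : ∫⁻ y : E3, (if ‖y‖ < 1 then F (‖y‖⁻¹ • y) else 0)
      = ∫⁻ y in ({0}ᶜ : Set E3), (if ‖y‖ < 1 then F (‖y‖⁻¹ • y) else 0) := by
    rw [restrict_compl_singleton]
  rw [h2, ← lintegral_subtype_comap (measurableSet_singleton _).compl]
  have h3 := (volume : Measure E3).measurePreserving_homeomorphUnitSphereProd.lintegral_comp
    (f := fun p : Metric.sphere (0 : E3) 1 × Set.Ioi (0 : ℝ) =>
      F p.1 * (if (p.2 : ℝ) < 1 then 1 else 0)) (by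
        refine Measurable.mul (hF.comp (by fun_prop)) ?_
        refine Measurable.ite (measurableSet_lt (by fun_prop) (by fun_prop)) ?_ ?_ <;> fun_prop)
  have h4 : ∀ y : ({0}ᶜ : Set E3), (if ‖(y : E3)‖ < 1 then F (‖(y : E3)‖⁻¹ • (y : E3)) else 0)
      = F ((homeomorphUnitSphereProd E3 y).1) *
        (if ((homeomorphUnitSphereProd E3 y).2 : ℝ) < 1 then 1 else 0) := by
    intro y
    simp [homeomorphUnitSphereProd]
  simp_rw [h4]
  rw [h3, lintegral_prod_mul (f := fun y : Metric.sphere (0 : E3) 1 => F y)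
    (g := fun r : Set.Ioi (0 : ℝ) => if (r : ℝ) < 1 then (1 : ℝ≥0∞) else 0), mul_comm]
  · congr 1
    have h5 : (fun r : Set.Ioi (0 : ℝ) => if (r : ℝ) < 1 then (1 : ℝ≥0∞) else 0)
        = Set.indicator (Set.Iio (⟨1, Set.mem_Ioi.2 one_pos⟩ : Set.Ioi (0 : ℝ))) 1 := by
      ext r
      simp only [Set.indicator, Set.mem_Iio, ← Subtype.coe_lt_coe, Pi.one_apply]
    rw [h5, lintegral_indicator_one measurableSet_Iio, Measure.volumeIoiPow_apply_Iio]
    norm_num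
  · exact (hF.comp (by fun_prop)).aemeasurable
  · refine (Measurable.ite (measurableSet_lt (by fun_prop) (by fun_prop)) ?_ ?_).aemeasurable <;> fun_prop

theorem lintegral_orthonormal_coords (b : OrthonormalBasis (Fin 3) ℝ E3) (Φ : E3 → ℝ≥0∞)
    (hΦ : Measurable Φ) :
    ∫⁻ y, Φ y = ∫⁻ z : ℝ, ∫⁻ p : ℝ × ℝ, Φ (z • b 0 + p.1 • b 1 + p.2 • b 2) := by
  have e1 := (b.measurePreserving_repr_symm).comp (PiLp.volume_preserving_toLp (Fin 3))
  have e2 := e1.comp (volume_preserving_piFinSuccAbove (fun _ : Fin 3 => ℝ) 0).symm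
  rw [← e2.lintegral_comp hΦ, Measure.volume_eq_prod, lintegral_prod _ (by
    exact (hΦ.comp e2.measurable).aemeasurable)]
  refine lintegral_congr fun z => ?_
  have e3 := (volume_preserving_finTwoArrow ℝ).symm
  rw [← e3.lintegral_comp (by
    exact (hΦ.comp e2.measurable).comp measurable_prodMk_left)]
  refine lintegral_congr fun p => ?_
  congr 1
  simp only [Function.comp_apply, ← OrthonormalBasis.sum_repr_symm, Fin.sum_univ_three]
  rfl

theorem lintegral_spherical_coords (Φ : ℝ × ℝ × ℝ → ℝ≥0∞) (hΦ : Measurable Φ) :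
    ∫⁻ z : ℝ, ∫⁻ p : ℝ × ℝ, Φ (z, p) =
      ∫⁻ r in Set.Ioi (0 : ℝ), ∫⁻ α in Set.Ioo 0 π, ∫⁻ θ in Set.Ioo (-π) π,
        ENNReal.ofReal (r * (r * Real.sin α)) *
          Φ (r * Real.cos α, r * Real.sin α * Real.cos θ, r * Real.sin α * Real.sin θ) := by
  let G : ℝ × ℝ → ℝ≥0∞ := fun q => if 0 < q.2 then
    ∫⁻ θ in Set.Ioo (-π) π, ENNReal.ofReal q.2 * Φ (q.1, q.2 * Real.cos θ, q.2 * Real.sin θ) else 0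
  have hG : Measurable G := by
    refine Measurable.ite (measurableSet_lt (by fun_prop) (by fun_prop)) ?_ (by fun_prop)
    refine Measurable.lintegral_prod_right' (f := fun x : (ℝ × ℝ) × ℝ => ENNReal.ofReal x.1.2 *
      Φ (x.1.1, x.1.2 * Real.cos x.2, x.1.2 * Real.sin x.2)) ?_
    exact Measurable.mul (by fun_prop) (hΦ.comp (by fun_prop))
  have h1 : ∫⁻ z : ℝ, ∫⁻ p : ℝ × ℝ, Φ (z, p) = ∫⁻ q : ℝ × ℝ, G q := by
    rw [Measure.volume_eq_prod, lintegral_prod _ hG.aemeasurable]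
    refine lintegral_congr fun z => ?_
    rw [← Measure.volume_eq_prod, ← lintegral_comp_polarCoord_symm, polarCoord_target,
      Measure.volume_eq_prod, ← Measure.prod_restrict, lintegral_prod]
    · rw [← lintegral_indicator measurableSet_Ioi]
      refine lintegral_congr fun ρ => ?_
      simp only [Set.indicator, Set.mem_Ioi, G, polarCoord_symm_apply, smul_eq_mul]
    · simp only [polarCoord_symm_apply, smul_eq_mul]
      exact (Measurable.mul (by fun_prop) (hΦ.comp (by fun_prop))).aemeasurable
  rw [h1, ← lintegral_comp_polarCoord_symm, polarCoord_target,
      Measure.volume_eq_prod, ← Measure.prod_restrict, lintegral_prod]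
  · refine setLIntegral_congr_fun measurableSet_Ioi fun r hr => ?_
    have hr : 0 < r := hr
    have hsub : Set.Ioo 0 π ⊆ Set.Ioo (-π) π := Set.Ioo_subset_Ioo_left (by linarith [Real.pi_pos])
    rw [← lintegral_indicator measurableSet_Ioo, ← lintegral_indicator measurableSet_Ioo]
    refine lintegral_congr fun α => ?_
    simp only [Set.indicator, polarCoord_symm_apply, smul_eq_mul, G]
    by_cases hα : α ∈ Set.Ioo 0 π
    · rw [if_pos (hsub hα), if_pos hα, if_pos (mul_pos hr (Real.sin_pos_of_mem_Ioo hα)),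
        ← lintegral_const_mul]
      · simp_rw [← mul_assoc, ← ENNReal.ofReal_mul hr.le, ← mul_assoc]
      · exact Measurable.mul (by fun_prop) (hΦ.comp (by fun_prop))
    · rw [if_neg hα]
      split_ifs with h2 h3
      · exfalso
        have : 0 < Real.sin α := pos_of_mul_pos_right h3 hr.le
        rcases le_or_gt α 0 with h | h
        · exact absurd (Real.sin_nonpos_of_nonpos_of_neg_pi_le h h2.1.le) (not_le.2 this)
        · exact hα ⟨h, h2.2⟩
      · simp
      · rfl
  · simp only [polarCoord_symm_apply, smul_eq_mul]
    exact (Measurable.mul (by fun_prop) (hG.comp (by fun_prop))).aemeasurable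

theorem norm_spherical_point (b : OrthonormalBasis (Fin 3) ℝ E3) (α θ : ℝ) :
    ‖Real.cos α • b 0 + (Real.sin α * Real.cos θ) • b 1 + (Real.sin α * Real.sin θ) • b 2‖ = 1 := by
  have h : Real.cos α • b 0 + (Real.sin α * Real.cos θ) • b 1 + (Real.sin α * Real.sin θ) • b 2
      = b.repr.symm (WithLp.toLp 2 ![Real.cos α, Real.sin α * Real.cos θ, Real.sin α * Real.sin θ]) := by
    simp [← OrthonormalBasis.sum_repr_symm, Fin.sum_univ_three]
  rw [h, LinearIsometryEquiv.norm_map, EuclideanSpace.norm_eq, Real.sqrt_eq_one]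
  simp [Fin.sum_univ_three]
  nlinarith [Real.sin_sq_add_cos_sq α, Real.sin_sq_add_cos_sq θ]

theorem lintegral_toSphere_eq (b : OrthonormalBasis (Fin 3) ℝ E3) (F : E3 → ℝ≥0∞)
    (hF : Measurable F) :
    ∫⁻ y : Metric.sphere (0 : E3) 1, F y ∂(volume : Measure E3).toSphere =
      ∫⁻ α in Set.Ioo 0 π, ∫⁻ θ in Set.Ioo (-π) π, ENNReal.ofReal (Real.sin α) *
        F (Real.cos α • b 0 + (Real.sin α * Real.cos θ) • b 1 + (Real.sin α * Real.sin θ) • b 2) := by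
  have h0 := lintegral_ball_eq_toSphere F hF
  have hm : Measurable fun y : E3 => (if ‖y‖ < 1 then F (‖y‖⁻¹ • y) else 0) := by
    refine Measurable.ite (measurableSet_lt (by fun_prop) (by fun_prop)) ?_ (by fun_prop)
    exact hF.comp (by fun_prop)
  rw [lintegral_orthonormal_coords b _ hm] at h0
  have h1 := lintegral_spherical_coords (fun p =>
    (fun y : E3 => (if ‖y‖ < 1 then F (‖y‖⁻¹ • y) else 0)) (p.1 • b 0 + p.2.1 • b 1 + p.2.2 • b 2))
    (hm.comp (by fun_prop))
  simp only at h1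
  rw [h1] at h0
  set J := ∫⁻ α in Set.Ioo 0 π, ∫⁻ θ in Set.Ioo (-π) π, ENNReal.ofReal (Real.sin α) *
        F (Real.cos α • b 0 + (Real.sin α * Real.cos θ) • b 1 + (Real.sin α * Real.sin θ) • b 2)
  have h2 : ∀ r ∈ Set.Ioi (0 : ℝ), (∫⁻ α in Set.Ioo 0 π, ∫⁻ θ in Set.Ioo (-π) π,
        ENNReal.ofReal (r * (r * Real.sin α)) *
          (if ‖(r * Real.cos α) • b 0 + (r * Real.sin α * Real.cos θ) • b 1 +
              (r * Real.sin α * Real.sin θ) • b 2‖ < 1 then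
            F (‖(r * Real.cos α) • b 0 + (r * Real.sin α * Real.cos θ) • b 1 +
              (r * Real.sin α * Real.sin θ) • b 2‖⁻¹ • ((r * Real.cos α) • b 0 +
              (r * Real.sin α * Real.cos θ) • b 1 + (r * Real.sin α * Real.sin θ) • b 2)) else 0))
      = (if r < 1 then ENNReal.ofReal (r ^ 2) else 0) * J := by
    intro r hr
    have hr : 0 < r := hr
    rw [← lintegral_const_mul' _ _ (by split_ifs <;> simp)]
    refine lintegral_congr fun α => ?_
    rw [← lintegral_const_mul' _ _ (by split_ifs <;> simp)]
    refine lintegral_congr fun θ => ?_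
    have h3 : (r * Real.cos α) • b 0 + (r * Real.sin α * Real.cos θ) • b 1 +
              (r * Real.sin α * Real.sin θ) • b 2 = r • (Real.cos α • b 0 +
                (Real.sin α * Real.cos θ) • b 1 + (Real.sin α * Real.sin θ) • b 2) := by
      simp only [smul_add, smul_smul, mul_assoc]
    rw [h3, norm_smul, norm_spherical_point, smul_smul, mul_one, Real.norm_of_nonneg hr.le,
      inv_mul_cancel₀ hr.ne', one_smul]
    split_ifs
    · rw [← mul_assoc (ENNReal.ofReal (r ^ 2)), ← ENNReal.ofReal_mul (by positivity), pow_two,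
        mul_assoc r r]
    · simp
  rw [setLIntegral_congr_fun measurableSet_Ioi h2, lintegral_mul_const] at h0
  · have h4 : ∫⁻ r in Set.Ioi (0 : ℝ), (if r < 1 then ENNReal.ofReal (r ^ 2) else 0)
        = ENNReal.ofReal (1 / 3) := by
      have : (fun r : ℝ => if r < 1 then ENNReal.ofReal (r ^ 2) else 0)
          = Set.indicator (Set.Iio 1) fun r => ENNReal.ofReal (r ^ 2) := by
        ext r; simp [Set.indicator]
      rw [this, setLIntegral_indicator measurableSet_Iio, Set.inter_comm, Set.Ioi_inter_Iio,
        ← ofReal_integral_eq_lintegral_ofReal, ← integral_Ioc_eq_integral_Ioo,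
        ← intervalIntegral.integral_of_le zero_le_one, integral_pow]
      · norm_num
      · exact (Continuous.integrableOn_Icc (by fun_prop)).mono_set Set.Ioo_subset_Icc_self
      · exact Filter.Eventually.of_forall fun r => by positivity
    rw [h4] at h0
    exact ((ENNReal.mul_right_inj (by simp) (by simp)).1 h0).symm
  · exact Measurable.ite measurableSet_Iio (by fun_prop) (by fun_prop)

theorem integral_toSphere_eq (b : OrthonormalBasis (Fin 3) ℝ E3) (F : E3 → ℝ) (hF : Continuous F)
    (hF0 : ∀ y, 0 ≤ F y) :
    ∫ y : Metric.sphere (0 : E3) 1, F y ∂(volume : Measure E3).toSphere =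
      ∫ α in Set.Ioo 0 π, ∫ θ in Set.Ioo (-π) π, Real.sin α *
        F (Real.cos α • b 0 + (Real.sin α * Real.cos θ) • b 1 + (Real.sin α * Real.sin θ) • b 2) := by
  have h := lintegral_toSphere_eq b (fun y => ENNReal.ofReal (F y)) (by fun_prop)
  rw [integral_eq_lintegral_of_nonneg_ae (f := fun y : Metric.sphere (0 : E3) 1 => F y)
    (Filter.Eventually.of_forall fun y => hF0 y)
    (by fun_prop), h]
  have hin : ∀ α ∈ Set.Ioo 0 π, (∫⁻ θ in Set.Ioo (-π) π, ENNReal.ofReal (Real.sin α) *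
      ENNReal.ofReal (F (Real.cos α • b 0 + (Real.sin α * Real.cos θ) • b 1 +
        (Real.sin α * Real.sin θ) • b 2))) =
      ENNReal.ofReal (∫ θ in Set.Ioo (-π) π, Real.sin α *
        F (Real.cos α • b 0 + (Real.sin α * Real.cos θ) • b 1 + (Real.sin α * Real.sin θ) • b 2)) := by
    intro α hα
    have hs := Real.sin_pos_of_mem_Ioo hα
    rw [ofReal_integral_eq_lintegral_ofReal]
    · refine lintegral_congr fun θ => ?_
      rw [ENNReal.ofReal_mul hs.le]
    · exact (Continuous.integrableOn_Icc (by fun_prop)).mono_set Set.Ioo_subset_Icc_self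
    · exact Filter.Eventually.of_forall fun θ => mul_nonneg hs.le (hF0 _)
  rw [setLIntegral_congr_fun measurableSet_Ioo hin, integral_eq_lintegral_of_nonneg_ae]
  · filter_upwards [ae_restrict_mem measurableSet_Ioo] with α hα
    exact integral_nonneg fun θ => mul_nonneg (Real.sin_pos_of_mem_Ioo hα).le (hF0 _)
  · have hc : Continuous fun α : ℝ => ∫ θ in (-π)..π, Real.sin α *
        F (Real.cos α • b 0 + (Real.sin α * Real.cos θ) • b 1 + (Real.sin α * Real.sin θ) • b 2) :=
      intervalIntegral.continuous_parametric_intervalIntegral_of_continuous' (by fun_prop) _ _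
    simp_rw [intervalIntegral.integral_of_le (show -π ≤ π by linarith [Real.pi_pos]),
      integral_Ioc_eq_integral_Ioo] at hc
    exact hc.aestronglyMeasurable

theorem continuous_circAvg (G : E3 → ℝ) (hG : Continuous G) (x u v : E3) :
    Continuous (circAvg G x u v) := by
  unfold circAvg
  refine continuous_const.mul ?_
  exact intervalIntegral.continuous_parametric_intervalIntegral_of_continuous' (by fun_prop) _ _

theorem integral_circAvg_eq (b : OrthonormalBasis (Fin 3) ℝ E3) (F : E3 → ℝ) (hF : Continuous F)
    (hF0 : ∀ y, 0 ≤ F y) :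
    ∫ s in (-1 : ℝ)..1, circAvg F (b 0) (b 1) (b 2) s =
      (1 / (2 * π)) * ∫ y : Metric.sphere (0 : E3) 1, F y ∂(volume : Measure E3).toSphere := by
  rw [integral_toSphere_eq b F hF hF0]
  have hA := continuous_circAvg F hF (b 0) (b 1) (b 2)
  have h1 := intervalIntegral.integral_comp_mul_deriv (a := π) (b := 0) (f := Real.cos)
    (f' := fun x => -Real.sin x) (g := circAvg F (b 0) (b 1) (b 2))
    (fun x _ => Real.hasDerivAt_cos x) (by fun_prop) hA
  rw [Real.cos_pi, Real.cos_zero] at h1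
  rw [← h1, intervalIntegral.integral_symm, ← intervalIntegral.integral_neg,
    intervalIntegral.integral_of_le Real.pi_pos.le, integral_Ioc_eq_integral_Ioo,
    ← integral_const_mul]
  refine setIntegral_congr_fun measurableSet_Ioo fun α hα => ?_
  have hs := Real.sin_pos_of_mem_Ioo hα
  have hsq : Real.sqrt (1 - Real.cos α ^ 2) = Real.sin α := by
    rw [← Real.sin_sq, Real.sqrt_sq hs.le]
  simp only [Function.comp_apply, circAvg, hsq]
  rw [integral_const_mul, ← integral_Ioc_eq_integral_Ioo,
    ← intervalIntegral.integral_of_le (show -π ≤ π by linarith [Real.pi_pos])]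
  have hper : Function.Periodic (fun θ => F (Real.cos α • b 0 +
      Real.sin α • (Real.cos θ • b 1 + Real.sin θ • b 2))) (2 * π) := by
    intro θ; simp
  have h2 := hper.intervalIntegral_add_eq (-π) 0
  rw [show -π + 2 * π = π by ring, zero_add] at h2
  rw [← h2]
  simp only [smul_add, smul_smul, ← add_assoc]
  ring

theorem integral_abs_circAvg_le (b : OrthonormalBasis (Fin 3) ℝ E3) (G : E3 → ℝ)
    (hG : Continuous G) :
    ∫ s in (-1 : ℝ)..1, |circAvg G (b 0) (b 1) (b 2) s| ≤
      (1 / (2 * π)) * ∫ y : Metric.sphere (0 : E3) 1, |G y| ∂(volume : Measure E3).toSphere := by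
  rw [← integral_circAvg_eq b (fun y => |G y|) hG.abs fun y => abs_nonneg _]
  refine intervalIntegral.integral_mono_on (by norm_num)
    (continuous_circAvg G hG _ _ _).abs.continuousOn.intervalIntegrable
    (continuous_circAvg _ hG.abs _ _ _).continuousOn.intervalIntegrable fun s _ => ?_
  unfold circAvg
  rw [abs_mul, abs_of_pos (by positivity : 0 < 1 / (2 * π))]
  gcongr
  exact intervalIntegral.abs_integral_le_integral_abs (by positivity)

open Polynomial in
theorem exists_jacobi_ode (n : ℕ) : ∃ y : ℝ[X], y.natDegree ≤ n ∧
    y.eval 0 = ((n : ℝ) + 1) ^ 2 / 2 ∧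
    X * (2 - X) * derivative (derivative y) + (4 - 3 * X) * derivative y
      + C ((n : ℝ) * (n + 2)) * y = 0 := by
  let a : ℕ → ℝ := fun j => Nat.rec (((n : ℝ) + 1) ^ 2 / 2)
    (fun i ai => -(((n : ℝ) - i) * (n + i + 2) / (2 * (i + 1) * (i + 2))) * ai) j
  have ha : ∀ j : ℕ, 2 * ((j : ℝ) + 1) * (j + 2) * a (j + 1)
      = -(((n : ℝ) - j) * (n + j + 2)) * a j := by
    intro j
    change 2 * ((j : ℝ) + 1) * (j + 2) *
      (-(((n : ℝ) - j) * (n + j + 2) / (2 * (j + 1) * (j + 2))) * a j) = _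
    field_simp
  have hz : ∀ j, n < j → a j = 0 := by
    intro j hj
    induction j, hj using Nat.le_induction with
    | base =>
      have := ha n
      rw [sub_self, zero_mul, neg_zero, zero_mul] at this
      exact (mul_eq_zero.1 this).resolve_left (by positivity)
    | succ j hj ih =>
      have := ha j
      rw [ih, mul_zero] at this
      exact (mul_eq_zero.1 this).resolve_left (by positivity)
  let y : ℝ[X] := ∑ j ∈ Finset.range (n + 1), monomial j (a j)
  have hc : ∀ j, y.coeff j = a j := by
    intro j
    simp only [y, finsetSum_coeff, coeff_monomial, Finset.sum_ite_eq', Finset.mem_range]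
    split_ifs with h
    · rfl
    · exact (hz j (by omega)).symm
  refine ⟨y, ?_, ?_, ?_⟩
  · exact natDegree_le_iff_coeff_eq_zero.2 fun j hj => by rw [hc, hz j hj]
  · rw [← coeff_zero_eq_eval_zero, hc]
    rfl
  · have e : X * (2 - X) * derivative (derivative y) + (4 - 3 * X) * derivative y
      + C ((n : ℝ) * (n + 2)) * y = C 2 * (X * derivative (derivative y))
        - X * (X * derivative (derivative y)) + C 4 * derivative y
        - C 3 * (X * derivative y) + C ((n : ℝ) * (n + 2)) * y := by
      have h2 : (C (2 : ℝ)) = 2 := rfl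
      have h3 : (C (3 : ℝ)) = 3 := rfl
      have h4 : (C (4 : ℝ)) = 4 := rfl
      rw [h2, h3, h4]; ring
    rw [e]
    ext j
    have := ha j
    rw [coeff_add, coeff_C_mul, hc]
    rcases j with _ | _ | j
    · simp [coeff_derivative, hc] at this ⊢
      linarith
    · simp [coeff_derivative, hc, coeff_X_mul] at this ⊢
      ring_nf at this ⊢
      linarith
    · simp [coeff_derivative, hc, coeff_X_mul] at this ⊢
      ring_nf at this ⊢
      linarith

open Polynomial in
theorem integral_derivative_eval (r : ℝ[X]) :
    ∫ u in (0 : ℝ)..2, (derivative r).eval u = r.eval 2 - r.eval 0 :=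
  intervalIntegral.integral_eq_sub_of_hasDerivAt (fun u _ => r.hasDerivAt u)
    ((derivative r).continuous.intervalIntegrable _ _)

open Polynomial in
/-- A multiple of a Jacobi polynomial reproduces the value at the endpoint `0` of polynomials of
degree less than `N` on `[0, 2]`. -/
theorem exists_reproducing_kernel (N : ℕ) (hN : 2 ≤ N) : ∃ y : ℝ[X],
    (∀ p : ℝ[X], p.natDegree < N → ∫ u in (0 : ℝ)..2, p.eval u * y.eval u = p.eval 0) ∧
    (∀ u ∈ Set.Icc (0 : ℝ) 2, |y.eval u| ≤ (N : ℝ) ^ 2 / 2) ∧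
    ∫ u in (0 : ℝ)..2, |y.eval u| ≤ N := by
  obtain ⟨n, rfl⟩ : ∃ n, N = n + 1 := ⟨N - 1, by omega⟩
  have hn : 1 ≤ n := by omega
  have hn' : (1 : ℝ) ≤ n := by exact_mod_cast hn
  obtain ⟨y, hdeg, hy0, hode⟩ := exists_jacobi_ode n
  have hii : ∀ p : ℝ[X], IntervalIntegrable (fun u => p.eval u) volume 0 2 :=
    fun p => p.continuous.intervalIntegrable _ _
  have hμ0 : ∫ u in (0 : ℝ)..2, y.eval u = 1 := by
    have h := integral_derivative_eval (X * (2 - X) * derivative y + (2 - X) * y)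
    have e : derivative (X * (2 - X) * derivative y + (2 - X) * y)
        = C (-(((n : ℝ) + 1) ^ 2)) * y := by
      have e2 : (C (-(((n : ℝ) + 1) ^ 2)) : ℝ[X]) = -C ((n : ℝ) * (n + 2)) - 1 := by
        rw [← C_1, ← C_neg, ← C_sub]; congr 1; ring
      rw [e2]
      simp only [derivative_add, derivative_mul, derivative_sub, derivative_X, derivative_ofNat]
      linear_combination hode
    rw [e] at h
    simp only [eval_mul, eval_C, intervalIntegral.integral_const_mul] at h
    simp [hy0] at h
    have hpos : (0 : ℝ) < ((n : ℝ) + 1) ^ 2 := by positivity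
    have : ((n : ℝ) + 1) ^ 2 * (∫ u in (0 : ℝ)..2, y.eval u) = ((n : ℝ) + 1) ^ 2 * 1 := by linarith
    exact mul_left_cancel₀ hpos.ne' this
  have hrec : ∀ j : ℕ, ((n : ℝ) * (n + 2) - j * (j + 2)) * (∫ u in (0 : ℝ)..2, (X ^ (j + 1) * y).eval u)
      + 2 * j * (j + 1) * (∫ u in (0 : ℝ)..2, (X ^ j * y).eval u) = 0 := by
    intro j
    have h := integral_derivative_eval
      (X ^ j * (X ^ 2 * (2 - X) * derivative y) - C (j : ℝ) * (2 * X ^ (j + 1) - X ^ (j + 2)) * y)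
    have e : derivative (X ^ j * (X ^ 2 * (2 - X) * derivative y)
        - C (j : ℝ) * (2 * X ^ (j + 1) - X ^ (j + 2)) * y)
        = -(C ((n : ℝ) * (n + 2) - j * (j + 2)) * (X ^ (j + 1) * y)
          + C (2 * (j : ℝ) * (j + 1)) * (X ^ j * y)) := by
      have hC2 : (C (2 : ℝ)) = 2 := rfl
      have e2 : (C ((n : ℝ) * (n + 2) - j * (j + 2)) : ℝ[X])
          = C ((n : ℝ) * (n + 2)) - (j : ℝ[X]) * (j + 2) := by
        rw [C_sub, C_mul (a := (j : ℝ)), C_add (a := (j : ℝ)), C_eq_natCast, hC2]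
      have e3 : (C (2 * (j : ℝ) * (j + 1)) : ℝ[X]) = 2 * (j : ℝ[X]) * (j + 1) := by simp [hC2]
      have e4 : (C (j : ℝ) : ℝ[X]) = (j : ℝ[X]) := by simp
      rw [e2, e3, e4]
      generalize C ((n : ℝ) * (n + 2)) = κ at hode
      rcases j with _ | j
      · simp only [derivative_mul, derivative_sub, derivative_X, derivative_ofNat,
          derivative_X_pow, derivative_natCast]
        simp [hC2]
        linear_combination X * hode
      · simp only [derivative_mul, derivative_sub, derivative_X, derivative_ofNat,
          derivative_X_pow, derivative_natCast]
        simp [hC2]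
        linear_combination X ^ (j + 2) * hode
    rw [e] at h
    simp only [eval_neg, eval_add, eval_mul (p := C _), eval_C] at h
    rw [intervalIntegral.integral_neg, intervalIntegral.integral_add
      ((hii _).const_mul _) ((hii _).const_mul _), intervalIntegral.integral_const_mul,
      intervalIntegral.integral_const_mul] at h
    simp [-eval_mul] at h
    have h5 : eval 2 (X ^ j * (X ^ 2 * (2 - X) * derivative y) - (j : ℝ[X]) * (2 * X ^ (j + 1) - X ^ (j + 2)) * y) = 0 := by
      simp; left; right; ring
    have h6 : eval 0 (X ^ j * (X ^ 2 * (2 - X) * derivative y) - (j : ℝ[X]) * (2 * X ^ (j + 1) - X ^ (j + 2)) * y) = 0 := by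
      simp
    simp only [eval_sub] at h5 h6
    linarith
  have hμ : ∀ j : ℕ, j < n → ∫ u in (0 : ℝ)..2, (X ^ (j + 1) * y).eval u = 0 := by
    intro j
    induction j with
    | zero =>
      intro _
      have := hrec 0
      simp only [CharP.cast_eq_zero, zero_mul, mul_zero, sub_zero, add_zero] at this
      exact (mul_eq_zero.1 this).resolve_left (by positivity)
    | succ j ih =>
      intro hj
      have := hrec (j + 1)
      rw [ih (by omega), mul_zero, add_zero] at this
      refine (mul_eq_zero.1 this).resolve_left ?_
      have : ((j + 1 : ℕ) : ℝ) < n := by exact_mod_cast hj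
      have h0 : (0 : ℝ) ≤ ((j + 1 : ℕ) : ℝ) := by positivity
      nlinarith
  have hrep : ∀ p : ℝ[X], p.natDegree < n + 1 →
      ∫ u in (0 : ℝ)..2, p.eval u * y.eval u = p.eval 0 := by
    intro p hp
    have e : ∀ u, p.eval u * y.eval u
        = ∑ j ∈ Finset.range (n + 1), p.coeff j * (X ^ j * y).eval u := by
      intro u
      rw [eval_eq_sum_range' hp, Finset.sum_mul]
      simp [mul_assoc]
    simp_rw [e]
    rw [intervalIntegral.integral_finsetSum fun j _ => (hii _).const_mul _]
    simp_rw [intervalIntegral.integral_const_mul]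
    rw [Finset.sum_range_succ', Finset.sum_eq_zero]
    · simp [hμ0, coeff_zero_eq_eval_zero]
    · intro j hj
      rw [hμ j (Finset.mem_range.1 hj), mul_zero]
  have hsq : ∫ u in (0 : ℝ)..2, y.eval u ^ 2 = y.eval 0 := by
    rw [← hrep y (by omega)]
    simp_rw [pow_two]
  have hy2 : |y.eval 2| ≤ y.eval 0 := by
    have hc : ∫ u in (0 : ℝ)..2, y.eval (2 - u) * y.eval u = y.eval 2 := by
      have := hrep (y.comp (2 - X)) (by
        refine lt_of_le_of_lt natDegree_comp_le ?_
        have : (2 - X : ℝ[X]).natDegree ≤ 1 := by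
          refine (natDegree_sub_le _ _).trans ?_
          simp
        nlinarith)
      simpa using this
    have hsq2 : ∫ u in (0 : ℝ)..2, y.eval (2 - u) ^ 2 = y.eval 0 := by
      rw [intervalIntegral.integral_comp_sub_left (fun u => y.eval u ^ 2) 2]
      simpa using hsq
    have hyc := y.continuous
    have hc2 : Continuous fun u : ℝ => y.eval (2 - u) := hyc.comp (by fun_prop)
    have hcc : IntervalIntegrable (fun u => y.eval (2 - u) * y.eval u) volume 0 2 :=
      (hc2.mul hyc).intervalIntegrable _ _
    have hs1 : IntervalIntegrable (fun u => y.eval u ^ 2) volume 0 2 :=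
      (hyc.pow 2).intervalIntegrable _ _
    have hs2 : IntervalIntegrable (fun u => y.eval (2 - u) ^ 2) volume 0 2 :=
      (hc2.pow 2).intervalIntegrable _ _
    have hp : ∫ u in (0 : ℝ)..2, (y.eval u ^ 2 + y.eval (2 - u) ^ 2) = 2 * y.eval 0 := by
      rw [intervalIntegral.integral_add hs1 hs2, hsq, hsq2]; ring
    rw [abs_le]
    constructor
    · have : ∫ u in (0 : ℝ)..2, -(2 * (y.eval (2 - u) * y.eval u)) ≤
          ∫ u in (0 : ℝ)..2, (y.eval u ^ 2 + y.eval (2 - u) ^ 2) :=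
        intervalIntegral.integral_mono_on (by norm_num) (hcc.const_mul 2).neg (hs1.add hs2)
          fun u _ => by nlinarith [sq_nonneg (y.eval u + y.eval (2 - u))]
      rw [intervalIntegral.integral_neg, intervalIntegral.integral_const_mul, hc, hp] at this
      linarith
    · have : ∫ u in (0 : ℝ)..2, (2 * (y.eval (2 - u) * y.eval u)) ≤
          ∫ u in (0 : ℝ)..2, (y.eval u ^ 2 + y.eval (2 - u) ^ 2) :=
        intervalIntegral.integral_mono_on (by norm_num) (hcc.const_mul 2) (hs1.add hs2)
          fun u _ => by nlinarith [sq_nonneg (y.eval u - y.eval (2 - u))]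
      rw [intervalIntegral.integral_const_mul, hc, hp] at this
      linarith
  have hy0pos : 0 ≤ y.eval 0 := by rw [hy0]; positivity
  refine ⟨y, hrep, ?_, ?_⟩
  · set c : ℝ := (n : ℝ) * (n + 2) with hcdef
    have hcpos : 0 < c := by positivity
    let E : ℝ → ℝ := fun u => c * y.eval u ^ 2 + u * (2 - u) * (derivative y).eval u ^ 2
    have hE : ∀ u, HasDerivAt E ((4 * u - 6) * (derivative y).eval u ^ 2) u := by
      intro u
      have h1 := ((y.hasDerivAt u).pow 2).const_mul c
      have h2 := ((hasDerivAt_id u).mul ((hasDerivAt_id u).const_sub 2)).mul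
        (((derivative y).hasDerivAt u).pow 2)
      refine (h1.add h2).congr_deriv ?_
      have := congrArg (eval u) hode
      simp at this
      simp
      linear_combination 2 * (derivative y).eval u * this
    have hEc : Continuous E := by
      have := y.continuous
      have := (derivative y).continuous
      fun_prop
    have hanti : AntitoneOn E (Set.Icc 0 (3 / 2)) := by
      refine antitoneOn_of_deriv_nonpos (convex_Icc _ _) hEc.continuousOn
        (fun u _ => (hE u).differentiableAt.differentiableWithinAt) fun u hu => ?_
      rw [interior_Icc] at hu
      rw [(hE u).deriv]
      exact mul_nonpos_of_nonpos_of_nonneg (by linarith [hu.2]) (sq_nonneg _)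
    have hmono : MonotoneOn E (Set.Icc (3 / 2) 2) := by
      refine monotoneOn_of_deriv_nonneg (convex_Icc _ _) hEc.continuousOn
        (fun u _ => (hE u).differentiableAt.differentiableWithinAt) fun u hu => ?_
      rw [interior_Icc] at hu
      rw [(hE u).deriv]
      exact mul_nonneg (by linarith [hu.1]) (sq_nonneg _)
    intro u hu
    have hEu : E u ≤ c * y.eval 0 ^ 2 := by
      rcases le_total u (3 / 2) with h | h
      · have := hanti (Set.mem_Icc.2 ⟨le_rfl, by norm_num⟩) ⟨hu.1, h⟩ hu.1
        simpa [E] using this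
      · have := hmono ⟨h, hu.2⟩ (Set.mem_Icc.2 ⟨by norm_num, le_rfl⟩) hu.2
        refine this.trans ?_
        have h3 : y.eval 2 ^ 2 ≤ y.eval 0 ^ 2 := by
          rw [← sq_abs]; exact pow_le_pow_left₀ (abs_nonneg _) hy2 2
        simp only [E]
        nlinarith
    have h1 : y.eval u ^ 2 ≤ y.eval 0 ^ 2 := by
      have h2 : 0 ≤ u * (2 - u) * (derivative y).eval u ^ 2 :=
        mul_nonneg (mul_nonneg hu.1 (by linarith [hu.2])) (sq_nonneg _)
      have h3 : c * y.eval u ^ 2 ≤ c * y.eval 0 ^ 2 := by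
        simp only [E] at hEu; linarith
      exact le_of_mul_le_mul_left h3 hcpos
    push_cast
    rw [← hy0]
    exact abs_le_of_sq_le_sq h1 hy0pos
  · have hyc := y.continuous
    have hNpos : (0 : ℝ) < ((n + 1 : ℕ) : ℝ) := by positivity
    have h1 : ∫ u in (0 : ℝ)..2, |y.eval u| ≤
        ∫ u in (0 : ℝ)..2, (y.eval u ^ 2 / ((n + 1 : ℕ) : ℝ) + ((n + 1 : ℕ) : ℝ) / 4) := by
      refine intervalIntegral.integral_mono_on (by norm_num) (hyc.abs.intervalIntegrable _ _)
        (Continuous.intervalIntegrable (by fun_prop) _ _) fun u _ => ?_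
      rw [← sq_abs, div_add_div _ _ hNpos.ne' (by norm_num), le_div_iff₀ (by positivity)]
      nlinarith [sq_nonneg (2 * |y.eval u| - ((n + 1 : ℕ) : ℝ))]
    rw [intervalIntegral.integral_add (Continuous.intervalIntegrable (by fun_prop) _ _)
      (Continuous.intervalIntegrable (by fun_prop) _ _), intervalIntegral.integral_div, hsq, hy0]
      at h1
    refine h1.trans (le_of_eq ?_)
    push_cast
    simp
    field_simp
    ring

theorem cosh_mem_ellipseClosed_s12 {w : ℂ} {s : ℝ} (hs : 0 < s) (h0 : 0 ≤ w.re) (hw : w.re ≤ s) :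
    Complex.cosh w ∈ ellipseClosed s := by
  have hre : (Complex.cosh w).re = Real.cosh w.re * Real.cos w.im := by
    rw [← Complex.re_add_im w, Complex.cosh_add, Complex.cosh_mul_I, Complex.sinh_mul_I]
    simp [← Complex.ofReal_cosh, ← Complex.ofReal_sinh, ← Complex.ofReal_cos, ← Complex.ofReal_sin]
  have him : (Complex.cosh w).im = Real.sinh w.re * Real.sin w.im := by
    rw [← Complex.re_add_im w, Complex.cosh_add, Complex.cosh_mul_I, Complex.sinh_mul_I]
    simp [← Complex.ofReal_cosh, ← Complex.ofReal_sinh, ← Complex.ofReal_cos, ← Complex.ofReal_sin]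
  have hc : Real.cosh w.re ≤ Real.cosh s := by
    rw [Real.cosh_le_cosh, abs_of_nonneg h0, abs_of_pos hs]; exact hw
  have hsh : Real.sinh w.re ≤ Real.sinh s := Real.sinh_le_sinh.2 hw
  have h1 : Real.cosh w.re ^ 2 / Real.cosh s ^ 2 ≤ 1 := by
    rw [div_le_one (by positivity)]
    have := Real.cosh_pos w.re
    gcongr
  have h2 : Real.sinh w.re ^ 2 / Real.sinh s ^ 2 ≤ 1 := by
    have := Real.sinh_pos_iff.2 hs
    have := Real.sinh_nonneg_iff.2 h0
    rw [div_le_one (by positivity)]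
    gcongr
  change _ ≤ (1 : ℝ)
  rw [hre, him, mul_pow, mul_pow, mul_div_right_comm, mul_div_right_comm]
  nlinarith [Real.sin_sq_add_cos_sq w.im, sq_nonneg (Real.cos w.im), sq_nonneg (Real.sin w.im)]

theorem cosh_mem_ellipseBoundary_s12 {w : ℂ} (hw : 0 < w.re) :
    Complex.cosh w ∈ ellipseBoundary w.re := by
  have hre : (Complex.cosh w).re = Real.cosh w.re * Real.cos w.im := by
    rw [← Complex.re_add_im w, Complex.cosh_add, Complex.cosh_mul_I, Complex.sinh_mul_I]
    simp [← Complex.ofReal_cosh, ← Complex.ofReal_sinh, ← Complex.ofReal_cos, ← Complex.ofReal_sin]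
  have him : (Complex.cosh w).im = Real.sinh w.re * Real.sin w.im := by
    rw [← Complex.re_add_im w, Complex.cosh_add, Complex.cosh_mul_I, Complex.sinh_mul_I]
    simp [← Complex.ofReal_cosh, ← Complex.ofReal_sinh, ← Complex.ofReal_cos, ← Complex.ofReal_sin]
  change _ = (1 : ℝ)
  have h1 := Real.cosh_pos w.re
  have h2 := Real.sinh_pos_iff.2 hw
  rw [hre, him, mul_pow, mul_pow, mul_div_right_comm, mul_div_right_comm, div_self (by positivity),
    div_self (by positivity)]
  linarith [Real.sin_sq_add_cos_sq w.im]

theorem half_add_inv_eq_cosh_log {w : ℂ} (hw : w ≠ 0) :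
    (w + w⁻¹) / 2 = Complex.cosh (Complex.log w) := by
  rw [Complex.cosh, Complex.exp_neg, Complex.exp_log hw]

theorem norm_integral_cos_exp_le {h : ℂ → ℂ} {U : Set ℂ} {t M : ℝ} (ht : 0 < t)
    (hd : DifferentiableOn ℂ h U) (hU : ellipseClosed t ⊆ U)
    (hM : ∀ z ∈ ellipseBoundary t, ‖h z‖ ≤ M) (n : ℕ) :
    ‖∫ θ in (0 : ℝ)..2 * π, Complex.exp (-(n * θ * Complex.I)) * h (Real.cos θ)‖
      ≤ 2 * π * (M * Real.exp (-t) ^ n) := by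
  have hne : ∀ z : ℂ, 1 ≤ ‖z‖ → z ≠ 0 := fun z hz => norm_pos_iff.1 (by linarith)
  have hlog : ∀ z : ℂ, 1 ≤ ‖z‖ → ‖z‖ ≤ Real.exp t → 0 ≤ (Complex.log z).re ∧
      (Complex.log z).re ≤ t := fun z h1 h2 => by
    rw [Complex.log_re]
    exact ⟨Real.log_nonneg h1, (Real.log_le_iff_le_exp (by linarith)).2 h2⟩
  let f : ℂ → ℂ := fun z => z⁻¹ ^ n * h ((z + z⁻¹) / 2)
  have hm : ∀ z : ℂ, 1 ≤ ‖z‖ → ‖z‖ ≤ Real.exp t → (z + z⁻¹) / 2 ∈ U := fun z h1 h2 => by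
    rw [half_add_inv_eq_cosh_log (hne z h1)]
    exact hU (cosh_mem_ellipseClosed_s12 ht (hlog z h1 h2).1 (hlog z h1 h2).2)
  have hf : DifferentiableOn ℂ f {z | 1 ≤ ‖z‖ ∧ ‖z‖ ≤ Real.exp t} := by
    have hi : DifferentiableOn ℂ (fun z : ℂ => z⁻¹) {z | 1 ≤ ‖z‖ ∧ ‖z‖ ≤ Real.exp t} :=
      fun z hz => (differentiableAt_inv (hne z hz.1)).differentiableWithinAt
    exact (hi.pow n).mul (hd.comp ((differentiableOn_id.add hi).div_const 2)
      fun z hz => hm z hz.1 hz.2)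
  have key := Complex.circleIntegral_sub_center_inv_smul_eq_of_differentiable_on_annulus_off_countable
    (c := 0) one_pos (Real.one_le_exp ht.le) (f := f) Set.countable_empty
    (hf.continuousOn.mono fun z hz => by simpa [and_comm] using hz)
    (fun z hz => (hf z (by
        simp only [Set.sdiff_empty, Set.mem_sdiff, Metric.mem_ball, Metric.mem_closedBall,
          dist_zero_right, not_le] at hz
        exact ⟨hz.2.le, hz.1.le⟩)).differentiableAt (by
        simp only [Set.sdiff_empty, Set.mem_sdiff, Metric.mem_ball, Metric.mem_closedBall,
          dist_zero_right, not_le] at hz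
        have h1 : ∀ᶠ w : ℂ in nhds z, 1 < ‖w‖ := continuous_norm.continuousAt.eventually_const_lt hz.2
        have h2 : ∀ᶠ w : ℂ in nhds z, ‖w‖ < Real.exp t :=
          continuous_norm.continuousAt.eventually_lt_const hz.1
        filter_upwards [h1, h2] with w hw1 hw2 using ⟨hw1.le, hw2.le⟩))
  have hb : ‖∮ z in C(0, Real.exp t), (z - 0)⁻¹ • f z‖
      ≤ 2 * π * Real.exp t * (Real.exp (-t) * (Real.exp (-t) ^ n * M)) := by
    refine circleIntegral.norm_integral_le_of_norm_le_const (Real.exp_pos t).le fun z hz => ?_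
    have hz' : ‖z‖ = Real.exp t := by simpa using hz
    have h1 : 1 ≤ ‖z‖ := hz' ▸ Real.one_le_exp ht.le
    have hl : (Complex.log z).re = t := by rw [Complex.log_re, hz', Real.log_exp]
    rw [sub_zero, smul_eq_mul, norm_mul, norm_mul, norm_pow, norm_inv, hz', ← Real.exp_neg]
    gcongr
    rw [half_add_inv_eq_cosh_log (hne z h1)]
    exact hM _ (hl ▸ cosh_mem_ellipseBoundary_s12 (hl.symm ▸ ht))
  have he : ∮ z in C(0, 1), (z - 0)⁻¹ • f z = Complex.I *
      ∫ θ in (0 : ℝ)..2 * π, Complex.exp (-(n * θ * Complex.I)) * h (Real.cos θ) := by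
    rw [circleIntegral, ← intervalIntegral.integral_const_mul]
    refine intervalIntegral.integral_congr fun θ _ => ?_
    simp only [deriv_circleMap, sub_zero, smul_eq_mul, f, circleMap, Complex.ofReal_one, zero_add,
      one_mul, ← Complex.exp_neg]
    rw [← Complex.exp_nat_mul, Complex.ofReal_cos, Complex.cos, neg_mul]
    have : Complex.exp (θ * Complex.I) * Complex.exp (-(θ * Complex.I)) = 1 := by
      rw [← Complex.exp_add]; simp
    rw [mul_neg, mul_assoc (n : ℂ)]
    linear_combination (Complex.I * Complex.exp (-(n * (θ * Complex.I))) *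
      h ((Complex.exp (θ * Complex.I) + Complex.exp (-(θ * Complex.I))) / 2)) * this
  rw [key, he, norm_mul, Complex.norm_I, one_mul] at hb
  refine hb.trans_eq ?_
  rw [Real.exp_neg]
  field_simp

open Polynomial in
theorem exists_polynomial_approx {h : ℂ → ℂ} {U : Set ℂ} {t M : ℝ} (ht : 0 < t)
    (hd : DifferentiableOn ℂ h U) (hU : ellipseClosed t ⊆ U)
    (hM : ∀ z ∈ ellipseBoundary t, ‖h z‖ ≤ M) {φ : ℝ → ℝ} (hφ : Continuous φ)
    (hh : ∀ s ∈ Set.Icc (-1 : ℝ) 1, h s = φ s) {N : ℕ} (hN : 1 ≤ N) :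
    ∃ p : ℝ[X], p.natDegree < N ∧ ∀ s ∈ Set.Icc (-1 : ℝ) 1,
      |φ s - p.eval s| ≤ 2 * M * Real.exp (-t) ^ N / (1 - Real.exp (-t)) := by
  have : Fact (0 < 2 * π) := ⟨Real.two_pi_pos⟩
  have hM0 : 0 ≤ M := (norm_nonneg _).trans (hM _ (by
    simpa using cosh_mem_ellipseBoundary_s12 (w := (t : ℂ)) (by simpa using ht)))
  let F : C(AddCircle (2 * π), ℂ) :=
    ⟨fun θ => (φ (Real.Angle.cos θ) : ℂ),
      Complex.continuous_ofReal.comp (hφ.comp Real.Angle.continuous_cos)⟩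
  have hF : ∀ θ : ℝ, F (θ : AddCircle (2 * π)) = (φ (Real.cos θ) : ℂ) := fun θ => rfl
  have hcoeff : ∀ n : ℤ, fourierCoeff F n = (1 / (2 * π) : ℝ) •
      ∫ θ in (0 : ℝ)..2 * π, Complex.exp (-(n * θ * Complex.I)) * h (Real.cos θ) := by
    intro n
    rw [fourierCoeff_eq_intervalIntegral F n 0, zero_add]
    congr 1
    refine intervalIntegral.integral_congr fun θ _ => ?_
    rw [fourier_coe_apply, smul_eq_mul, hF, hh _ ⟨Real.neg_one_le_cos θ, Real.cos_le_one θ⟩]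
    congr 2
    push_cast
    have : (π : ℂ) ≠ 0 := by exact_mod_cast Real.pi_ne_zero
    field_simp
  have hneg : ∀ n : ℤ, fourierCoeff F (-n) = fourierCoeff F n := by
    intro n
    rw [hcoeff, hcoeff]
    congr 1
    have := intervalIntegral.integral_comp_sub_left (a := 0) (b := 2 * π)
      (fun θ : ℝ => Complex.exp (-(n * θ * Complex.I)) * h (Real.cos θ)) (2 * π)
    rw [sub_self, sub_zero] at this
    rw [← this]
    refine intervalIntegral.integral_congr fun θ _ => ?_
    rw [Real.cos_two_pi_sub]
    congr 1
    rw [Complex.exp_eq_exp_iff_exists_int]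
    refine ⟨n, ?_⟩
    push_cast
    ring
  have hbd : ∀ n : ℕ, ‖fourierCoeff F n‖ ≤ M * Real.exp (-t) ^ n := by
    intro n
    have := norm_integral_cos_exp_le ht hd hU hM n
    rw [hcoeff, norm_smul, Real.norm_of_nonneg (by positivity)]
    rw [one_div, inv_mul_le_iff₀ Real.two_pi_pos]
    exact this
  have hlt : Real.exp (-t) < 1 := by rw [Real.exp_lt_one_iff]; linarith
  have hgeo := (hasSum_geometric_of_lt_one (Real.exp_pos (-t)).le hlt).mul_left M
  have hsn : Summable fun n : ℕ => fourierCoeff F (n : ℤ) :=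
    Summable.of_norm_bounded hgeo.summable hbd
  have hs : Summable (fourierCoeff F) := hsn.of_nat_of_neg (by simpa only [hneg] using hsn)
  let c : ℕ → ℝ := fun n => 2 * (fourierCoeff F n).re
  have hc : ∀ n, |c n| ≤ 2 * (M * Real.exp (-t) ^ n) := fun n => by
    rw [abs_mul, abs_two]
    have := (Complex.abs_re_le_norm (fourierCoeff F n)).trans (hbd n)
    linarith
  have hsum : ∀ θ : ℝ, HasSum (fun n : ℕ => c n * Real.cos (n * θ))
      (φ (Real.cos θ) + (fourierCoeff F 0).re) := by
    intro θ
    have h1 := (has_pointwise_sum_fourier_series_of_summable hs (θ : AddCircle (2 * π))).nat_add_neg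
    have h2 := Complex.hasSum_re h1
    convert h2 using 1
    · ext n
      rw [hneg, ← smul_add, smul_eq_mul]
      have : (fourier (n : ℤ)) (θ : AddCircle (2 * π)) + (fourier (-(n : ℤ))) (θ : AddCircle (2 * π))
          = ((2 * Real.cos (n * θ) : ℝ) : ℂ) := by
        rw [fourier_coe_apply, fourier_coe_apply]
        push_cast
        rw [Complex.cos]
        have : (π : ℂ) ≠ 0 := by exact_mod_cast Real.pi_ne_zero
        field_simp
      rw [this, Complex.re_mul_ofReal]
      ring
    · rw [hF]
      simp
  refine ⟨∑ n ∈ Finset.range N, C (c n) * Chebyshev.T ℝ n - C (fourierCoeff F 0).re, ?_, ?_⟩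
  · rw [natDegree_sub_C]
    refine (natDegree_sum_le_of_forall_le (n := N - 1) _ _ fun n hn => ?_).trans_lt (by omega)
    refine (natDegree_C_mul_le _ _).trans ?_
    rw [Chebyshev.natDegree_T]
    have := Finset.mem_range.1 hn
    omega
  · intro s hs
    have h1 := (hasSum_nat_add_iff' N).2 (hsum (Real.arccos s))
    rw [Real.cos_arccos hs.1 hs.2] at h1
    have h2 := ((hasSum_geometric_of_lt_one (Real.exp_pos (-t)).le hlt).mul_left
      (2 * M * Real.exp (-t) ^ N))
    have h3 := h1.norm_le_of_bounded h2 fun n => by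
      rw [norm_mul, Real.norm_eq_abs, Real.norm_eq_abs]
      calc _ ≤ 2 * (M * Real.exp (-t) ^ (n + N)) * 1 :=
            mul_le_mul (hc _) (Real.abs_cos_le_one _) (abs_nonneg _) (by positivity)
        _ = _ := by ring
    rw [← div_eq_mul_inv, Real.norm_eq_abs] at h3
    refine le_of_eq_of_le (congrArg _ ?_) h3
    rw [eval_sub, eval_C, eval_finsetSum]
    have : ∀ n : ℕ, (C (c n) * Chebyshev.T ℝ n).eval s = c n * Real.cos (n * Real.arccos s) := by
      intro n
      have := Chebyshev.T_real_cos (Real.arccos s) n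
      rw [Real.cos_arccos hs.1 hs.2] at this
      rw [eval_mul, eval_C, this]
      simp
    simp only [this]
    ring

open Polynomial in
theorem abs_apply_one_le_of_polynomial_approx {φ : ℝ → ℝ} (hφ : Continuous φ) {p : ℝ[X]} {N : ℕ}
    (hN : 2 ≤ N) (hp : p.natDegree < N) {ε : ℝ}
    (hε : ∀ s ∈ Set.Icc (-1 : ℝ) 1, |φ s - p.eval s| ≤ ε) :
    |φ 1| ≤ (1 + N) * ε + (N : ℝ) ^ 2 / 2 * ∫ s in (-1 : ℝ)..1, |φ s| := by
  obtain ⟨y, hy, hy1, hy2⟩ := exists_reproducing_kernel N hN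
  have hε0 : 0 ≤ ε := (abs_nonneg _).trans (hε 1 (by norm_num))
  have hq := hy (p.comp (1 - X)) (by
    rw [natDegree_comp, ← natDegree_neg (1 - X : ℝ[X]), neg_sub, ← C_1, natDegree_X_sub_C, mul_one]
    exact hp)
  simp only [eval_comp, eval_sub, eval_one, eval_X, sub_zero] at hq
  have hmem : ∀ u ∈ Set.Icc (0 : ℝ) 2, 1 - u ∈ Set.Icc (-1 : ℝ) 1 := fun u hu =>
    ⟨by linarith [hu.2], by linarith [hu.1]⟩
  have hsub : ∫ u in (0 : ℝ)..2, |φ (1 - u)| = ∫ s in (-1 : ℝ)..1, |φ s| := by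
    have := intervalIntegral.integral_comp_sub_left (a := 0) (b := 2) (fun s => |φ s|) 1
    norm_num at this
    exact this
  have hle : |p.eval 1| ≤ ∫ u in (0 : ℝ)..2, ((N : ℝ) ^ 2 / 2 * |φ (1 - u)| + ε * |y.eval u|) := by
    rw [← hq]
    refine (intervalIntegral.abs_integral_le_integral_abs zero_le_two).trans ?_
    refine intervalIntegral.integral_mono_on zero_le_two
      (Continuous.intervalIntegrable (by fun_prop) _ _)
      (Continuous.intervalIntegrable (by fun_prop) _ _) fun u hu => ?_
    rw [abs_mul]
    have h1 : |p.eval (1 - u)| ≤ |φ (1 - u)| + ε := by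
      have := hε _ (hmem u hu)
      rw [abs_sub_comm] at this
      linarith [abs_sub_abs_le_abs_sub (p.eval (1 - u)) (φ (1 - u))]
    have h2 := mul_le_mul_of_nonneg_right h1 (abs_nonneg (y.eval u))
    have h3 := mul_le_mul_of_nonneg_left (hy1 u hu) (abs_nonneg (φ (1 - u)))
    linarith
  rw [intervalIntegral.integral_add (Continuous.intervalIntegrable (by fun_prop) _ _)
    (Continuous.intervalIntegrable (by fun_prop) _ _), intervalIntegral.integral_const_mul,
    intervalIntegral.integral_const_mul, hsub] at hle
  have h4 := mul_le_mul_of_nonneg_left hy2 hε0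
  have h5 := abs_sub_abs_le_abs_sub (φ 1) (p.eval 1)
  have h6 := hε 1 (by norm_num)
  linarith

theorem exists_orthonormalBasis_apply_zero_eq (x : E3) (hx : ‖x‖ = 1) :
    ∃ b : OrthonormalBasis (Fin 3) ℝ E3, b 0 = x := by
  have hv : Orthonormal ℝ (({0} : Set (Fin 3)).domRestrict fun _ => x) :=
    ⟨fun _ => hx, fun i j hij => (hij (Subsingleton.elim i j)).elim⟩
  obtain ⟨b, hb⟩ := hv.exists_orthonormalBasis_extension_of_card_eq (by simp)
  exact ⟨b, hb 0 rfl⟩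

theorem norm_circle_point {x u v : E3} (hx : ‖x‖ = 1) (hu : ‖u‖ = 1) (hv : ‖v‖ = 1)
    (hxu : inner ℝ x u = 0) (hxv : inner ℝ x v = 0) (huv : inner ℝ u v = 0) {t : ℝ}
    (ht : t ∈ Set.Icc (-1 : ℝ) 1) (s : ℝ) :
    ‖t • x + √(1 - t ^ 2) • (Real.cos s • u + Real.sin s • v)‖ = 1 := by
  have hs : √(1 - t ^ 2) ^ 2 = 1 - t ^ 2 := Real.sq_sqrt (by nlinarith [ht.1, ht.2])
  have h1 : ‖Real.cos s • u + Real.sin s • v‖ ^ 2 = 1 := by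
    rw [norm_add_sq_real, norm_smul, norm_smul, inner_smul_left, inner_smul_right, huv, hu, hv]
    simp
  rw [← sq_eq_sq₀ (norm_nonneg _) zero_le_one, norm_add_sq_real, norm_smul, norm_smul, mul_pow,
    mul_pow, h1, hx, inner_smul_left, inner_smul_right, inner_add_right, inner_smul_right,
    inner_smul_right, hxu, hxv, Real.norm_eq_abs, Real.norm_eq_abs, sq_abs, sq_abs, hs]
  simp

theorem memAlambdaSphere.nonneg_s12 {lam : ℝ → EReal} {g : E3 → ℝ} {Ng : ℝ}
    (hg : memAlambdaSphere lam g Ng) (hB : 0 < Blam lam) : 0 ≤ Ng := by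
  obtain ⟨b, -⟩ := exists_orthonormalBasis_apply_zero_eq (EuclideanSpace.single 0 1) (by simp)
  obtain ⟨h, -, -, hM⟩ := hg (b 0) (b 1) (b 2) (by simp) (by simp) (by simp)
    (b.orthonormal.2 (by decide)) (b.orthonormal.2 (by decide)) (b.orthonormal.2 (by decide))
  obtain ⟨t, ht, htB⟩ := EReal.lt_iff_exists_real_btwn.1 hB
  have ht : 0 < t := by exact_mod_cast ht
  refine le_trans (by positivity) (hM t ht htB _
    (by simpa using cosh_mem_ellipseBoundary_s12 (w := (t : ℂ)) (by simpa using ht)))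

theorem memAlambdaSphere.abs_apply_le {lam : ℝ → EReal} {g : E3 → ℝ} {Ng : ℝ}
    (hg : memAlambdaSphere lam g Ng) (hgc : ContinuousOn g (Metric.sphere 0 1))
    {x : E3} (hx : x ∈ Metric.sphere (0 : E3) 1) {t : ℝ} (ht : 0 < t)
    (htB : ((t : ℝ) : EReal) < Blam lam) {N : ℕ} (hN : 2 ≤ N) :
    |g x| ≤ (1 + N) *
        (2 * (Real.exp (lam t).toReal * Ng) * Real.exp (-t) ^ N / (1 - Real.exp (-t)))
      + (N : ℝ) ^ 2 / (4 * π) *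
        ∫ y : Metric.sphere (0 : E3) 1, |g y| ∂(volume : Measure E3).toSphere := by
  obtain ⟨G, hG⟩ := ContinuousMap.exists_restrict_eq (Metric.isClosed_sphere (x := (0 : E3)) (ε := 1))
    ⟨_, hgc.domRestrict⟩
  have hGg : ∀ y ∈ Metric.sphere (0 : E3) 1, G y = g y := fun y hy =>
    DFunLike.congr_fun hG (⟨y, hy⟩ : Metric.sphere (0 : E3) 1)
  obtain ⟨b, rfl⟩ := exists_orthonormalBasis_apply_zero_eq x (by simpa using hx)
  have h01 : inner ℝ (b 0) (b 1) = 0 := b.orthonormal.2 (by decide)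
  have h02 : inner ℝ (b 0) (b 2) = 0 := b.orthonormal.2 (by decide)
  have h12 : inner ℝ (b 1) (b 2) = 0 := b.orthonormal.2 (by decide)
  obtain ⟨h, hd, hh, hM⟩ := hg (b 0) (b 1) (b 2) (by simp) (by simp) (by simp) h01 h02 h12
  have hcirc : ∀ s ∈ Set.Icc (-1 : ℝ) 1,
      circAvg G (b 0) (b 1) (b 2) s = circAvg g (b 0) (b 1) (b 2) s := by
    intro s hs
    unfold circAvg
    congr 1
    refine intervalIntegral.integral_congr fun θ _ => hGg _ ?_
    rw [mem_sphere_zero_iff_norm]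
    exact norm_circle_point (by simp) (by simp) (by simp) h01 h02 h12 hs θ
  have hone : circAvg G (b 0) (b 1) (b 2) 1 = g (b 0) := by
    simp [circAvg, hGg _ hx]
    field_simp
  have hφ := continuous_circAvg G G.continuous (b 0) (b 1) (b 2)
  have hU : ellipseClosed t ⊆ ellipseRegion lam := fun z hz => ⟨t, ht, htB, hz⟩
  have hIcc : ∀ s ∈ Set.Icc (-1 : ℝ) 1, (s : ℂ) ∈ ellipseClosed t := by
    intro s hs
    have h1 := Real.one_le_cosh t
    have h2 : s ^ 2 ≤ Real.cosh t ^ 2 := by nlinarith [hs.1, hs.2]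
    have : s ^ 2 / Real.cosh t ^ 2 ≤ 1 := (div_le_one (by positivity)).2 h2
    simpa [ellipseClosed] using this
  have heq : Set.EqOn (fun s : ℝ => h s) (fun s => (circAvg G (b 0) (b 1) (b 2) s : ℂ))
      (Set.Icc (-1) 1) := by
    refine Set.EqOn.of_subset_closure (s := Set.Ioo (-1) 1) (fun s hs => ?_) ?_ ?_
      Set.Ioo_subset_Icc_self (closure_Ioo (by norm_num)).ge
    · simp only [hh s hs, hcirc s (Set.Ioo_subset_Icc_self hs)]
    · exact hd.continuousOn.comp Complex.continuous_ofReal.continuousOn fun s hs => hU (hIcc s hs)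
    · exact (Complex.continuous_ofReal.comp hφ).continuousOn
  obtain ⟨p, hp, hpε⟩ := exists_polynomial_approx ht hd hU
    (M := Real.exp (lam t).toReal * Ng) (fun z hz => by
      have := hM t ht htB z hz
      rwa [Real.exp_neg, inv_mul_le_iff₀ (Real.exp_pos _)] at this) hφ heq (N := N) (by omega)
  have key := abs_apply_one_le_of_polynomial_approx hφ hN hp hpε
  rw [hone] at key
  refine key.trans (add_le_add_right ?_ _)
  have hint : ∫ y : Metric.sphere (0 : E3) 1, |G y| ∂(volume : Measure E3).toSphere
      = ∫ y : Metric.sphere (0 : E3) 1, |g y| ∂(volume : Measure E3).toSphere :=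
    integral_congr_ae (.of_forall fun y => by simp only [hGg y y.2])
  have h7 := mul_le_mul_of_nonneg_left (integral_abs_circAvg_le b G G.continuous)
    (by positivity : (0 : ℝ) ≤ (N : ℝ) ^ 2 / 2)
  rw [hint] at h7
  refine h7.trans_eq ?_
  field_simp
  ring

/-- `L^∞`-`L¹` interpolation inequality on the sphere for functions in
`A^λ(S²)` (Theorem 3.7, part 4): there are `δ₀ > 0` and `c_λ, d_λ > 0` such that
`‖g‖_{L^∞(S²)} ≤ (c_λ + √(4π/δ) d_λ) exp(-λ*(⌊√(4π/δ)⌋ - 1)) ‖g‖_{A^λ(S²)}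
+ (1/δ) ‖g‖_{L¹(S²)}` for all `0 < δ ≤ δ₀`. -/
theorem interpolation_inequality_sphere
    (lam : ℝ → EReal) (hlam_bot : ∀ r, lam r ≠ ⊥)
    (hlam_mono : MonotoneOn lam (Set.Ici 0))
    (hBpos : 0 < Blam lam) :
    ∃ (δ₀ c d : ℝ), 0 < δ₀ ∧ 0 < c ∧ 0 < d ∧
      ∀ (g : EuclideanSpace ℝ (Fin 3) → ℝ),
        ContinuousOn g (Metric.sphere (0 : EuclideanSpace ℝ (Fin 3)) 1) →
      ∀ (Ng : ℝ), memAlambdaSphere lam g Ng →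
      ∀ (δ : ℝ), 0 < δ → δ ≤ δ₀ →
      ∀ x ∈ Metric.sphere (0 : EuclideanSpace ℝ (Fin 3)) 1,
        |g x|
          ≤ (c + Real.sqrt (4 * π / δ) * d) *
              expNegLamStar lam (((⌊Real.sqrt (4 * π / δ)⌋ : ℤ) : ℝ) - 1) * Ng
            + (1 / δ) *
                ∫ y : Metric.sphere (0 : EuclideanSpace ℝ (Fin 3)) 1, |g y|
                  ∂(volume : Measure (EuclideanSpace ℝ (Fin 3))).toSphere := by
  have hmono : ∀ {r s : ℝ}, 0 ≤ r → r ≤ s → lam s ≠ ⊤ → lam r ≠ ⊤ ∧ (lam r).toReal ≤ (lam s).toReal :=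
    fun {r s} hr hrs hs => by
      have h := hlam_mono hr (hr.trans hrs) hrs
      exact ⟨ne_top_of_le_ne_top hs h, EReal.toReal_le_toReal h (hlam_bot r) hs⟩
  have hfin : ∀ t : ℝ, 0 ≤ t → (t : EReal) < Blam lam → lam t ≠ ⊤ := by
    intro t ht htB
    obtain ⟨_, ⟨r, -, hr, rfl⟩, htr⟩ := lt_sSup_iff.1 htB
    exact (hmono ht (by exact_mod_cast htr.le) hr).1
  obtain ⟨r₀, hr₀, hr₀B⟩ := EReal.lt_iff_exists_real_btwn.1 hBpos
  have hr₀ : 0 < r₀ := by exact_mod_cast hr₀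
  have hr₀fin := hfin r₀ hr₀.le hr₀B
  set a := (lam r₀).toReal
  set l := (lam 0).toReal
  have hla : l ≤ a := (hmono le_rfl hr₀.le hr₀fin).2
  have he : 0 < 1 - Real.exp (-(r₀ / 2)) := by
    rw [sub_pos, Real.exp_lt_one_iff]; linarith
  set c := 2 / (1 - Real.exp (-(r₀ / 2)))
  have hc : 0 < c := by positivity
  set K := 1 + 2 * (a - l) / r₀
  have hK : 1 ≤ K := le_add_of_nonneg_right (div_nonneg (by linarith) hr₀.le)
  refine ⟨4 * π / (K + 1) ^ 2, c, c, by positivity, hc, hc, fun g hgc Ng hg δ hδ hδ₀ x hx => ?_⟩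
  have hNg := hg.nonneg_s12 hBpos
  set S := √(4 * π / δ)
  have hS2 : S ^ 2 = 4 * π / δ := Real.sq_sqrt (by positivity)
  have hSK : K + 1 ≤ S := by
    refine Real.le_sqrt_of_sq_le ?_
    rw [le_div_iff₀ (by positivity)] at hδ₀
    rw [le_div_iff₀ hδ]
    linarith
  set N := ⌊S⌋₊
  have hN2 : 2 ≤ N := Nat.le_floor (by push_cast; linarith)
  have hNS : (N : ℝ) ≤ S := Nat.floor_le (by linarith)
  have hSN : S < N + 1 := Nat.lt_floor_add_one S
  rw [← natCast_floor_eq_intCast_floor (R := ℝ) (by linarith : (0 : ℝ) ≤ S)]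
  set I := ∫ y : Metric.sphere (0 : E3) 1, |g y| ∂(volume : Measure E3).toSphere
  have hI : 0 ≤ I := integral_nonneg fun _ => abs_nonneg _
  have hbound : ∀ t : ℝ, r₀ / 2 ≤ t → (t : EReal) < Blam lam →
      |g x| - 1 / δ * I ≤ (c + S * c) * Ng * Real.exp ((lam t).toReal - (N - 1) * t) := by
    intro t ht htB
    have ht0 : 0 < t := by linarith
    have h1 := hg.abs_apply_le hgc hx ht0 htB hN2
    have h2 : (N : ℝ) ^ 2 / (4 * π) ≤ 1 / δ := by
      rw [div_le_div_iff₀ (by positivity) hδ, one_mul, ← le_div_iff₀ hδ, ← hS2]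
      gcongr
    have h3 := mul_le_mul_of_nonneg_right h2 hI
    have h4 : Real.exp (lam t).toReal * Real.exp (-t) ^ N
        ≤ Real.exp ((lam t).toReal - (N - 1) * t) := by
      rw [← Real.exp_nat_mul, ← Real.exp_add, Real.exp_le_exp]
      linarith
    have h5 : 2 / (1 - Real.exp (-t)) ≤ c := by
      have : Real.exp (-t) ≤ Real.exp (-(r₀ / 2)) := Real.exp_le_exp.2 (by linarith)
      exact div_le_div_of_nonneg_left zero_le_two he (by linarith)
    have h7 : 0 ≤ 2 / (1 - Real.exp (-t)) :=
      div_nonneg zero_le_two (sub_nonneg.2 (Real.exp_le_one_iff.2 (by linarith)))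
    have h6 : (1 + N) * (2 * (Real.exp (lam t).toReal * Ng) * Real.exp (-t) ^ N /
        (1 - Real.exp (-t))) ≤ (c + S * c) * Ng * Real.exp ((lam t).toReal - (N - 1) * t) :=
      calc _ = (1 + N) * (2 / (1 - Real.exp (-t))) * Ng *
            (Real.exp (lam t).toReal * Real.exp (-t) ^ N) := by ring
        _ ≤ (1 + S) * c * Ng * Real.exp ((lam t).toReal - (N - 1) * t) := by
            gcongr
        _ = _ := by ring
    linarith
  have hinf : ∀ r : ℝ, 0 ≤ r → lam r ≠ ⊤ →
      |g x| - 1 / δ * I ≤ (c + S * c) * Ng * Real.exp ((lam r).toReal - (N - 1) * r) := by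
    intro r hr hrfin
    rcases le_or_gt r (r₀ / 2) with hle | hlt
    · refine (hbound r₀ (by linarith) hr₀B).trans ?_
      have hlr : l ≤ (lam r).toReal := (hmono le_rfl hr hrfin).2
      have hKN : 2 * (a - l) / r₀ ≤ N - 1 := by simp only [K] at hSK; linarith
      rw [div_le_iff₀ hr₀] at hKN
      have hN1 : (0 : ℝ) ≤ N - 1 := by linarith
      have h1 := mul_le_mul_of_nonneg_left hle hN1
      have h2 : 0 ≤ c + S * c := by positivity
      gcongr ?_ * Real.exp ?_
      linarith
    · have hrB : (r : EReal) ≤ Blam lam := le_sSup ⟨r, hr, hrfin, rfl⟩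
      have hlim : Filter.Tendsto
          (fun t : ℝ => (c + S * c) * Ng * Real.exp ((lam r).toReal - (N - 1) * t))
          (nhdsWithin r (Set.Iio r))
          (nhds ((c + S * c) * Ng * Real.exp ((lam r).toReal - (N - 1) * r))) :=
        ((by fun_prop : Continuous
          fun t : ℝ => (c + S * c) * Ng * Real.exp ((lam r).toReal - (N - 1) * t)).tendsto
            r).mono_left nhdsWithin_le_nhds
      refine ge_of_tendsto hlim ?_
      filter_upwards [Ioo_mem_nhdsLT hlt] with t ht
      refine (hbound t ht.1.le ((EReal.coe_lt_coe_iff.2 ht.2).trans_le hrB)).trans ?_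
      have h1 := (hmono (by linarith [ht.1]) ht.2.le hrfin).2
      gcongr
  have hA : 0 ≤ (c + S * c) * Ng := by positivity
  have hfinal : |g x| - 1 / δ * I ≤ (c + S * c) * Ng * expNegLamStar lam (N - 1) := by
    have hne : {y : ℝ | ∃ r : ℝ, 0 ≤ r ∧ lam r ≠ ⊤ ∧
        y = Real.exp ((lam r).toReal - ((N : ℝ) - 1) * r)}.Nonempty := ⟨_, r₀, hr₀.le, hr₀fin, rfl⟩
    rcases hA.eq_or_lt with h0 | h0
    · have := hinf r₀ hr₀.le hr₀fin
      rw [← h0, zero_mul] at this ⊢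
      exact this
    · rw [← div_le_iff₀' h0]
      refine le_csInf hne ?_
      rintro _ ⟨r, hr, hrfin, rfl⟩
      rw [div_le_iff₀' h0]
      exact hinf r hr hrfin
  linarith
end
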